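/- arXiv:math/0210461 — 2 statements merged into one kernel-verified Lean document; each statement's English description precedes it below -/
import Mathlib

section
/- Let k be a field, H a commutative Hopf algebra over k with bijective antipode, and let N, P be left-right Yetter-Drinfeld modules over H with N finitely generated and projective as a left H-module. Then the injective dimension of Hom_H(N, P) in the category of Yetter-Drinfeld modules is at most the injective dimension of P in that category. -/
/-!
Common definitions for formalizing "Semisimplicity of the categories of
Yetter-Drinfeld modules and Long dimodules" (Caenepeel, Guédénon).
-/

open TensorProduct

noncomputable section
namespace YDPaper

section RingPart

variable (k H : Type) [CommRing k] [Ring H] [HopfAlgebra k H]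

/-- `ρ : M →ₗ[k] M ⊗[k] H` is a (coassociative, counital) right `H`-comodule
structure on `M`. -/
def IsComod {M : Type} [AddCommGroup M] [Module k M] (ρ : M →ₗ[k] M ⊗[k] H) : Prop :=
  (∀ m : M, (TensorProduct.rid k M)
      ((LinearMap.lTensor M (Coalgebra.counit (R := k) (A := H))) (ρ m)) = m) ∧
  (∀ m : M, (TensorProduct.assoc k M H H) ((LinearMap.rTensor H ρ) (ρ m)) =
      (LinearMap.lTensor M (Coalgebra.comul (R := k) (A := H))) (ρ m))

/-- The iterated comultiplication `h ↦ (h₁ ⊗ h₂) ⊗ h₃`. -/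
def Delta2 : H →ₗ[k] (H ⊗[k] H) ⊗[k] H :=
  (LinearMap.rTensor H (Coalgebra.comul (R := k) (A := H))).comp
    (Coalgebra.comul (R := k) (A := H))

/-- The Yetter-Drinfeld compatibility condition
`ρ(h • m) = h₂ • m₀ ⊗ h₃ m₁ S⁻¹(h₁)`, expressed via arbitrary Sweedler
decompositions of `Δ²(h)` and `ρ(m)` into finite sums of pure tensors. -/
def IsYDCompat (Sinv : H →ₗ[k] H) {M : Type} [AddCommGroup M] [Module k M] [Module H M]
    (ρ : M →ₗ[k] M ⊗[k] H) : Prop :=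
  ∀ (h : H) (m : M) (s t : Finset ℕ) (a b c : ℕ → H) (m₀ : ℕ → M) (m₁ : ℕ → H),
    (∑ i ∈ s, (a i ⊗ₜ[k] b i) ⊗ₜ[k] c i) = Delta2 k H h →
    (∑ j ∈ t, m₀ j ⊗ₜ[k] m₁ j) = ρ m →
    ρ (h • m) = ∑ i ∈ s, ∑ j ∈ t, (b i • m₀ j) ⊗ₜ[k] (c i * m₁ j * Sinv (a i))

/-- The `k`-linear map `m ↦ h • m`. -/
def smulMap {M : Type} [AddCommGroup M] [Module k M] [Module H M] [SMulCommClass H k M]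
    (h : H) : M →ₗ[k] M where
  toFun m := h • m
  map_add' := smul_add h
  map_smul' c m := (smul_comm h c m)

/-- The Long dimodule compatibility condition `ρ(h • m) = h • m₀ ⊗ m₁`. -/
def IsLongCompat {M : Type} [AddCommGroup M] [Module k M] [Module H M] [SMulCommClass H k M]
    (ρ : M →ₗ[k] M ⊗[k] H) : Prop :=
  ∀ (h : H) (m : M), ρ (h • m) = (LinearMap.rTensor H (smulMap k H h)) (ρ m)

/-- Morphisms in the categories of Yetter-Drinfeld modules and of Long dimodules:
`H`-linear and `H`-colinear maps. -/
def IsHom {A B : Type} [AddCommGroup A] [Module k A] [Module H A]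
    [AddCommGroup B] [Module k B] [Module H B]
    (ρA : A →ₗ[k] A ⊗[k] H) (ρB : B →ₗ[k] B ⊗[k] H) (f : A →ₗ[k] B) : Prop :=
  (∀ (h : H) (a : A), f (h • a) = h • f a) ∧
  ρB.comp f = (LinearMap.rTensor H f).comp ρA

/-- `H`-colinearity of a `k`-linear map between right `H`-comodules. -/
def IsColin {A B : Type} [AddCommGroup A] [Module k A]
    [AddCommGroup B] [Module k B]
    (ρA : A →ₗ[k] A ⊗[k] H) (ρB : B →ₗ[k] B ⊗[k] H) (f : A →ₗ[k] B) : Prop :=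
  ρB.comp f = (LinearMap.rTensor H f).comp ρA

/-- A bundled left-right Yetter-Drinfeld module over `H` (with chosen inverse `Sinv`
of the antipode). -/
structure YDCat (Sinv : H →ₗ[k] H) where
  M : Type
  [iAdd : AddCommGroup M]
  [iModk : Module k M]
  [iModH : Module H M]
  [iTower : IsScalarTower k H M]
  [iComm : SMulCommClass H k M]
  ρ : M →ₗ[k] M ⊗[k] H
  comod : IsComod k H ρ
  compat : IsYDCompat k H Sinv ρ

attribute [instance] YDCat.iAdd YDCat.iModk YDCat.iModH YDCat.iTower YDCat.iComm

/-- A bundled left-right Long dimodule over `H`. -/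
structure LongCat where
  M : Type
  [iAdd : AddCommGroup M]
  [iModk : Module k M]
  [iModH : Module H M]
  [iTower : IsScalarTower k H M]
  [iComm : SMulCommClass H k M]
  ρ : M →ₗ[k] M ⊗[k] H
  comod : IsComod k H ρ
  compat : IsLongCompat k H ρ

attribute [instance] LongCat.iAdd LongCat.iModk LongCat.iModH LongCat.iTower LongCat.iComm

/-- A bundled right `H`-comodule. -/
structure ComodCat where
  V : Type
  [iAdd : AddCommGroup V]
  [iModk : Module k V]
  ρ : V →ₗ[k] V ⊗[k] H
  comod : IsComod k H ρ

attribute [instance] ComodCat.iAdd ComodCat.iModk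

section Subobjects

variable {k H}
variable {M : Type} [AddCommGroup M] [Module k M] [Module H M] [IsScalarTower k H M]

/-- A subobject in the category of Yetter-Drinfeld modules (or Long dimodules):
an `H`-submodule which is stable under the coaction, i.e. `ρ(p) ⊆ p ⊗ H`. -/
def IsSubobject (ρ : M →ₗ[k] M ⊗[k] H) (p : Submodule H M) : Prop :=
  ∀ m ∈ p, ρ m ∈ LinearMap.range (LinearMap.rTensor H (p.restrictScalars k).subtype)

/-- A simple subobject: a nonzero coaction-stable `H`-submodule with no proper
nonzero coaction-stable `H`-submodules. -/
def IsSimpleSubobject (ρ : M →ₗ[k] M ⊗[k] H) (p : Submodule H M) : Prop :=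
  IsSubobject ρ p ∧ p ≠ ⊥ ∧
    ∀ q : Submodule H M, IsSubobject ρ q → q ≤ p → q = ⊥ ∨ q = p

/-- `M` is the (internal) direct sum of a family of simple subobjects which are
finitely generated as `H`-modules. -/
def IsSemisimpleObj (ρ : M →ₗ[k] M ⊗[k] H) : Prop :=
  ∃ (ι : Type) (S : ι → Submodule H M),
    (∀ i, IsSimpleSubobject ρ (S i) ∧ (S i).FG) ∧
    iSupIndep S ∧ (⨆ i, S i) = ⊤

end Subobjects

section Subcomodules

variable {k H}
variable {V : Type} [AddCommGroup V] [Module k V]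

/-- A subcomodule: a `k`-submodule stable under the coaction. -/
def IsSubcomod (ρ : V →ₗ[k] V ⊗[k] H) (p : Submodule k V) : Prop :=
  ∀ v ∈ p, ρ v ∈ LinearMap.range (LinearMap.rTensor H p.subtype)

/-- A simple subcomodule. -/
def IsSimpleSubcomod (ρ : V →ₗ[k] V ⊗[k] H) (p : Submodule k V) : Prop :=
  IsSubcomod ρ p ∧ p ≠ ⊥ ∧
    ∀ q : Submodule k V, IsSubcomod ρ q → q ≤ p → q = ⊥ ∨ q = p

/-- A comodule is semisimple if it is the internal direct sum of a family of simple
subcomodules. -/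
def IsSemisimpleComod (ρ : V →ₗ[k] V ⊗[k] H) : Prop :=
  ∃ (ι : Type) (S : ι → Submodule k V),
    (∀ i, IsSimpleSubcomod ρ (S i)) ∧ iSupIndep S ∧ (⨆ i, S i) = ⊤

end Subcomodules

/-- `H` is cosemisimple: every right `H`-comodule is a direct sum of simple
subcomodules. -/
def Cosemisimple : Prop := ∀ C : ComodCat k H, IsSemisimpleComod C.ρ

section Coinv

variable {k H}
variable {A B : Type} [AddCommGroup A] [Module k A] [AddCommGroup B] [Module k B]

/-- The coinvariants `M^{co H} = { m | ρ m = m ⊗ 1 }` of a right `H`-comodule. -/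
def coinv (ρ : A →ₗ[k] A ⊗[k] H) : Submodule k A :=
  LinearMap.ker (ρ - (TensorProduct.mk k A H).flip 1)

lemma mem_coinv {ρ : A →ₗ[k] A ⊗[k] H} {a : A} :
    a ∈ coinv ρ ↔ ρ a = a ⊗ₜ[k] (1 : H) := by
  simp [coinv, LinearMap.mem_ker, sub_eq_zero]

/-- The map induced on coinvariants by an `H`-colinear map. -/
def coinvMap {ρA : A →ₗ[k] A ⊗[k] H} {ρB : B →ₗ[k] B ⊗[k] H} (f : A →ₗ[k] B)
    (hf : IsColin k H ρA ρB f) : ↥(coinv ρA) →ₗ[k] ↥(coinv ρB) :=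
  f.restrict (fun a ha => by
    have h1 : ρA a = a ⊗ₜ[k] (1 : H) := mem_coinv.1 ha
    have h2 : ρB (f a) = (LinearMap.rTensor H f) (ρA a) := by
      have := congrArg (fun (g : A →ₗ[k] B ⊗[k] H) => g a) hf
      simpa using this
    rw [mem_coinv, h2, h1, LinearMap.rTensor_tmul])

end Coinv

/-- Exactness of the coinvariants functor on the category of Yetter-Drinfeld
modules. -/
def CoinvExactYD (Sinv : H →ₗ[k] H) : Prop :=
  ∀ (A B C : YDCat k H Sinv) (f : A.M →ₗ[k] B.M) (g : B.M →ₗ[k] C.M)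
    (hf : IsHom k H A.ρ B.ρ f) (hg : IsHom k H B.ρ C.ρ g),
    Function.Injective f → Function.Surjective g →
    LinearMap.range f = LinearMap.ker g →
    Function.Injective (coinvMap f hf.2) ∧
    LinearMap.range (coinvMap f hf.2) = LinearMap.ker (coinvMap g hg.2) ∧
    Function.Surjective (coinvMap g hg.2)

/-- Exactness of the coinvariants functor on the category of right `H`-comodules. -/
def CoinvExactComod : Prop :=
  ∀ (A B C : ComodCat k H) (f : A.V →ₗ[k] B.V) (g : B.V →ₗ[k] C.V)
    (hf : IsColin k H A.ρ B.ρ f) (hg : IsColin k H B.ρ C.ρ g),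
    Function.Injective f → Function.Surjective g →
    LinearMap.range f = LinearMap.ker g →
    Function.Injective (coinvMap f hf) ∧
    LinearMap.range (coinvMap f hf) = LinearMap.ker (coinvMap g hg) ∧
    Function.Surjective (coinvMap g hg)

section Eval

variable {k H}
variable {M N : Type} [AddCommGroup M] [Module k M] [Module H M]
  [IsScalarTower k H M] [SMulCommClass H k M]
  [AddCommGroup N] [Module k N] [Module H N] [IsScalarTower k H N] [SMulCommClass H k N]

/-- Evaluation at `m` of `H`-linear maps, as a `k`-linear map. -/
def evalAtH (m : M) : (M →ₗ[H] N) →ₗ[k] N where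
  toFun f := f m
  map_add' _ _ := rfl
  map_smul' _ _ := rfl

/-- Evaluation at `m` of `k`-linear maps, as a `k`-linear map. -/
def evalAtK {V : Type} [AddCommGroup V] [Module k V] (v : V) :
    (V →ₗ[k] N) →ₗ[k] N where
  toFun f := f v
  map_add' _ _ := rfl
  map_smul' _ _ := rfl

/-- Contraction `N ⊗ H → N` along a functional `φ : H → k`. -/
def contract (φ : H →ₗ[k] k) : N ⊗[k] H →ₗ[k] N :=
  (TensorProduct.rid k N).toLinearMap.comp (LinearMap.lTensor N φ)

/-- Post-composition with an `H`-linear map, as a `k`-linear map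
`Hom_H(X, M) → Hom_H(X, N)`; here `X` is the (implicit) source. -/
def postcompH {X : Type} [AddCommGroup X] [Module k X] [Module H X]
    [IsScalarTower k H X] [SMulCommClass H k X]
    (f : M →ₗ[k] N) (hf : ∀ (h : H) (m : M), f (h • m) = h • f m) :
    (X →ₗ[H] M) →ₗ[k] (X →ₗ[H] N) where
  toFun φ :=
    { toFun := fun x => f (φ x)
      map_add' := fun x y => by simp
      map_smul' := fun h x => by simp [hf] }
  map_add' φ ψ := by ext x; simp
  map_smul' c φ := by ext x; simp

end Eval

/-- Condition (†) for the category of Yetter-Drinfeld modules: for every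
Yetter-Drinfeld module `X` which is finitely generated as a left `H`-module,
the functor `Hom_H(X, -)` is exact on the category of Yetter-Drinfeld modules. -/
def DaggerYD (Sinv : H →ₗ[k] H) : Prop :=
  ∀ X : YDCat k H Sinv, Module.Finite H X.M →
  ∀ (A B C : YDCat k H Sinv) (f : A.M →ₗ[k] B.M) (g : B.M →ₗ[k] C.M)
    (hf : IsHom k H A.ρ B.ρ f) (hg : IsHom k H B.ρ C.ρ g),
    Function.Injective f → Function.Surjective g →
    LinearMap.range f = LinearMap.ker g →
    Function.Injective (postcompH (X := X.M) f hf.1) ∧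
    LinearMap.range (postcompH (X := X.M) f hf.1) =
      LinearMap.ker (postcompH (X := X.M) g hg.1) ∧
    Function.Surjective (postcompH (X := X.M) g hg.1)

/-- Condition (†) for the category of Long dimodules. -/
def DaggerLong : Prop :=
  ∀ X : LongCat k H, Module.Finite H X.M →
  ∀ (A B C : LongCat k H) (f : A.M →ₗ[k] B.M) (g : B.M →ₗ[k] C.M)
    (hf : IsHom k H A.ρ B.ρ f) (hg : IsHom k H B.ρ C.ρ g),
    Function.Injective f → Function.Surjective g →
    LinearMap.range f = LinearMap.ker g →
    Function.Injective (postcompH (X := X.M) f hf.1) ∧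
    LinearMap.range (postcompH (X := X.M) f hf.1) =
      LinearMap.ker (postcompH (X := X.M) g hg.1) ∧
    Function.Surjective (postcompH (X := X.M) g hg.1)

/-- Projective object in the category of Yetter-Drinfeld modules. -/
def IsProjectiveYD (Sinv : H →ₗ[k] H) (P : YDCat k H Sinv) : Prop :=
  ∀ (A B : YDCat k H Sinv) (g : A.M →ₗ[k] B.M) (f : P.M →ₗ[k] B.M),
    IsHom k H A.ρ B.ρ g → Function.Surjective g → IsHom k H P.ρ B.ρ f →
    ∃ l : P.M →ₗ[k] A.M, IsHom k H P.ρ A.ρ l ∧ g.comp l = f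

/-- Projective object in the category of Long dimodules. -/
def IsProjectiveLong (P : LongCat k H) : Prop :=
  ∀ (A B : LongCat k H) (g : A.M →ₗ[k] B.M) (f : P.M →ₗ[k] B.M),
    IsHom k H A.ρ B.ρ g → Function.Surjective g → IsHom k H P.ρ B.ρ f →
    ∃ l : P.M →ₗ[k] A.M, IsHom k H P.ρ A.ρ l ∧ g.comp l = f

/-- Injective object in the category of Yetter-Drinfeld modules. -/
def IsInjectiveYD (Sinv : H →ₗ[k] H) (I : YDCat k H Sinv) : Prop :=
  ∀ (A B : YDCat k H Sinv) (ι : A.M →ₗ[k] B.M) (f : A.M →ₗ[k] I.M),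
    IsHom k H A.ρ B.ρ ι → Function.Injective ι → IsHom k H A.ρ I.ρ f →
    ∃ g : B.M →ₗ[k] I.M, IsHom k H B.ρ I.ρ g ∧ g.comp ι = f

/-- Projective object in the category of right `H`-comodules. -/
def IsProjectiveComod (P : ComodCat k H) : Prop :=
  ∀ (A B : ComodCat k H) (g : A.V →ₗ[k] B.V) (f : P.V →ₗ[k] B.V),
    IsColin k H A.ρ B.ρ g → Function.Surjective g → IsColin k H P.ρ B.ρ f →
    ∃ l : P.V →ₗ[k] A.V, IsColin k H P.ρ A.ρ l ∧ g.comp l = f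

section HomLemmas

variable {k H}
variable {A B C : Type} [AddCommGroup A] [Module k A] [Module H A]
  [AddCommGroup B] [Module k B] [Module H B]
  [AddCommGroup C] [Module k C] [Module H C]

lemma IsHom.comp' {ρA : A →ₗ[k] A ⊗[k] H} {ρB : B →ₗ[k] B ⊗[k] H} {ρC : C →ₗ[k] C ⊗[k] H}
    {f : A →ₗ[k] B} {g : B →ₗ[k] C}
    (hf : IsHom k H ρA ρB f) (hg : IsHom k H ρB ρC g) :
    IsHom k H ρA ρC (g.comp f) := by
  refine ⟨fun h a => by simp [LinearMap.comp_apply, hf.1, hg.1], ?_⟩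
  calc ρC.comp (g.comp f) = (ρC.comp g).comp f := by rw [LinearMap.comp_assoc]
    _ = ((LinearMap.rTensor H g).comp ρB).comp f := by rw [hg.2]
    _ = (LinearMap.rTensor H g).comp (ρB.comp f) := by rw [LinearMap.comp_assoc]
    _ = (LinearMap.rTensor H g).comp ((LinearMap.rTensor H f).comp ρA) := by rw [hf.2]
    _ = ((LinearMap.rTensor H g).comp (LinearMap.rTensor H f)).comp ρA := by
          rw [LinearMap.comp_assoc]
    _ = (LinearMap.rTensor H (g.comp f)).comp ρA := by rw [LinearMap.rTensor_comp]

end HomLemmas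

section HomYD

variable {k H}
variable (Sinv : H →ₗ[k] H)

/-- The `k`-module of morphisms of Yetter-Drinfeld modules `Hom_H^H(A, B)`, as a
submodule of the `k`-linear maps. -/
def homYD (A B : YDCat k H Sinv) : Submodule k (A.M →ₗ[k] B.M) where
  carrier := {f | IsHom k H A.ρ B.ρ f}
  add_mem' := by
    rintro f g ⟨hf1, hf2⟩ ⟨hg1, hg2⟩
    refine ⟨fun h a => by simp [hf1, hg1, smul_add], ?_⟩
    rw [LinearMap.comp_add, LinearMap.rTensor_add, LinearMap.add_comp, hf2, hg2]
  zero_mem' := by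
    refine ⟨fun h a => by simp, ?_⟩
    rw [LinearMap.comp_zero, LinearMap.rTensor_zero, LinearMap.zero_comp]
  smul_mem' := by
    rintro c f ⟨hf1, hf2⟩
    refine ⟨fun h a => by
      rw [LinearMap.smul_apply, LinearMap.smul_apply, hf1, smul_comm], ?_⟩
    rw [LinearMap.comp_smul, LinearMap.rTensor_smul, LinearMap.smul_comp, hf2]

/-- Post-composition with a morphism of Yetter-Drinfeld modules, as a `k`-linear map
between morphism spaces. -/
def postcompYD {X B C : YDCat k H Sinv}
    (g : B.M →ₗ[k] C.M) (hg : IsHom k H B.ρ C.ρ g) :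
    ↥(homYD Sinv X B) →ₗ[k] ↥(homYD Sinv X C) where
  toFun f := ⟨g.comp f.1, IsHom.comp' f.2 hg⟩
  map_add' f g' := by ext x; simp
  map_smul' c f := by ext x; simp

/-- An injective resolution `0 → X → I⁰ → I¹ → ⋯` in the category of
Yetter-Drinfeld modules. -/
structure IsInjRes (X : YDCat k H Sinv) (I : ℕ → YDCat k H Sinv)
    (ε : X.M →ₗ[k] (I 0).M) (d : ∀ n, (I n).M →ₗ[k] (I (n + 1)).M) : Prop where
  eps_hom : IsHom k H X.ρ (I 0).ρ ε
  d_hom : ∀ n, IsHom k H (I n).ρ (I (n + 1)).ρ (d n)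
  inj : ∀ n, IsInjectiveYD k H Sinv (I n)
  mono : Function.Injective ε
  exact0 : LinearMap.range ε = LinearMap.ker (d 0)
  exact : ∀ n, LinearMap.range (d n) = LinearMap.ker (d (n + 1))

/-- A projective resolution `⋯ → P₁ → P₀ → X → 0` in the category of
Yetter-Drinfeld modules. -/
structure IsProjRes (X : YDCat k H Sinv) (P : ℕ → YDCat k H Sinv)
    (ε : (P 0).M →ₗ[k] X.M) (d : ∀ n, (P (n + 1)).M →ₗ[k] (P n).M) : Prop where
  eps_hom : IsHom k H (P 0).ρ X.ρ ε
  d_hom : ∀ n, IsHom k H (P (n + 1)).ρ (P n).ρ (d n)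
  proj : ∀ n, IsProjectiveYD k H Sinv (P n)
  epi : Function.Surjective ε
  exact0 : LinearMap.range (d 0) = LinearMap.ker ε
  exact : ∀ n, LinearMap.range (d (n + 1)) = LinearMap.ker (d n)

/-- The projective dimension of `X` in the category of Yetter-Drinfeld modules is
at most `n`. -/
def pdimLE (X : YDCat k H Sinv) (n : ℕ) : Prop :=
  ∃ (P : ℕ → YDCat k H Sinv) (ε : (P 0).M →ₗ[k] X.M)
    (d : ∀ m, (P (m + 1)).M →ₗ[k] (P m).M),
    IsProjRes Sinv X P ε d ∧ ∀ i, n < i → Subsingleton (P i).M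

/-- The injective dimension of `X` in the category of Yetter-Drinfeld modules is
at most `n`. -/
def injdimLE (X : YDCat k H Sinv) (n : ℕ) : Prop :=
  ∃ (I : ℕ → YDCat k H Sinv) (ε : X.M →ₗ[k] (I 0).M)
    (d : ∀ m, (I m).M →ₗ[k] (I (m + 1)).M),
    IsInjRes Sinv X I ε d ∧ ∀ i, n < i → Subsingleton (I i).M

/-- The complex `Hom(X, I⁰) → Hom(X, I¹) → ⋯` of morphism spaces induced by a
cochain of Yetter-Drinfeld modules. -/
def homCx (X : YDCat k H Sinv) (I : ℕ → YDCat k H Sinv)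
    (d : ∀ n, (I n).M →ₗ[k] (I (n + 1)).M)
    (hd : ∀ n, IsHom k H (I n).ρ (I (n + 1)).ρ (d n)) (n : ℕ) :
    ↥(homYD Sinv X (I n)) →ₗ[k] ↥(homYD Sinv X (I (n + 1))) :=
  postcompYD Sinv (d n) (hd n)

/-- Coboundaries of the induced complex. -/
def boundaries (X : YDCat k H Sinv) (I : ℕ → YDCat k H Sinv)
    (d : ∀ n, (I n).M →ₗ[k] (I (n + 1)).M)
    (hd : ∀ n, IsHom k H (I n).ρ (I (n + 1)).ρ (d n)) :
    ∀ i, Submodule k ↥(homYD Sinv X (I i))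
  | 0 => ⊥
  | (i + 1) => LinearMap.range (homCx Sinv X I d hd i)

/-- The `i`-th cohomology (cocycles modulo coboundaries) of the complex
`Hom(X, I⁰) → Hom(X, I¹) → ⋯`; when `I` is an injective resolution of `Y`, this is
`Ext^i(X, Y)`, the `i`-th right derived functor of `Hom_H^H(X, -)`, in the category
of Yetter-Drinfeld modules. -/
abbrev cohomology (X : YDCat k H Sinv) (I : ℕ → YDCat k H Sinv)
    (d : ∀ n, (I n).M →ₗ[k] (I (n + 1)).M)
    (hd : ∀ n, IsHom k H (I n).ρ (I (n + 1)).ρ (d n)) (i : ℕ) : Type :=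
  ↥(Submodule.map (boundaries Sinv X I d hd i).mkQ
      (LinearMap.ker (homCx Sinv X I d hd i)))

end HomYD

section CharProps

variable {k H}
variable (Sinv : H →ₗ[k] H)

/-- Characterizing property of the coaction on `Hom_H(A, B)` for Yetter-Drinfeld
modules `A`, `B`: it is determined by `f₀(m) ⊗ f₁ = f(m₀)₀ ⊗ f(m₀)₁ S(m₁)`. -/
def HomCoactChar (A B : YDCat k H Sinv)
    (ρQ : (A.M →ₗ[H] B.M) →ₗ[k] (A.M →ₗ[H] B.M) ⊗[k] H) : Prop :=
  ∀ (f : A.M →ₗ[H] B.M) (m : A.M) (t : Finset ℕ) (m₀ : ℕ → A.M) (m₁ : ℕ → H),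
    (∑ j ∈ t, m₀ j ⊗ₜ[k] m₁ j) = A.ρ m →
    (LinearMap.rTensor H (evalAtH (N := B.M) m)) (ρQ f) =
      ∑ j ∈ t, (LinearMap.lTensor B.M
          (LinearMap.mulRight k (HopfAlgebra.antipode (R := k) (A := H) (m₁ j))))
        (B.ρ (f (m₀ j)))

/-- Characterizing property of the coaction on `Hom_k(V, B)` for a comodule `V` and
a Yetter-Drinfeld module `B`: `g₀(v) ⊗ g₁ = g(v₀)₀ ⊗ g(v₀)₁ S(v₁)`. -/
def HomKCoactChar (V : ComodCat k H) (B : YDCat k H Sinv)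
    (ρ' : (V.V →ₗ[k] B.M) →ₗ[k] (V.V →ₗ[k] B.M) ⊗[k] H) : Prop :=
  ∀ (g : V.V →ₗ[k] B.M) (v : V.V) (t : Finset ℕ) (v₀ : ℕ → V.V) (v₁ : ℕ → H),
    (∑ j ∈ t, v₀ j ⊗ₜ[k] v₁ j) = V.ρ v →
    (LinearMap.rTensor H (evalAtK (N := B.M) v)) (ρ' g) =
      ∑ j ∈ t, (LinearMap.lTensor B.M
          (LinearMap.mulRight k (HopfAlgebra.antipode (R := k) (A := H) (v₁ j))))
        (B.ρ (g (v₀ j)))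

/-- Characterizing property of the Yetter-Drinfeld coaction on `H ⊗ V`:
`ρ(h ⊗ v) = h₂ ⊗ v₀ ⊗ h₃ v₁ S⁻¹(h₁)`. -/
def HTensorYDChar (V : ComodCat k H)
    (ρT : (H ⊗[k] V.V) →ₗ[k] (H ⊗[k] V.V) ⊗[k] H) : Prop :=
  ∀ (h : H) (v : V.V) (s t : Finset ℕ) (a b c : ℕ → H) (v₀ : ℕ → V.V) (v₁ : ℕ → H),
    (∑ i ∈ s, (a i ⊗ₜ[k] b i) ⊗ₜ[k] c i) = Delta2 k H h →
    (∑ j ∈ t, v₀ j ⊗ₜ[k] v₁ j) = V.ρ v →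
    ρT (h ⊗ₜ[k] v) =
      ∑ i ∈ s, ∑ j ∈ t, (b i ⊗ₜ[k] v₀ j) ⊗ₜ[k] (c i * v₁ j * Sinv (a i))

/-- Characterizing property of the Long dimodule coaction on `H ⊗ V`:
`ρ(h ⊗ v) = h ⊗ v₀ ⊗ v₁`. -/
def HTensorLongChar (V : ComodCat k H)
    (ρT : (H ⊗[k] V.V) →ₗ[k] (H ⊗[k] V.V) ⊗[k] H) : Prop :=
  ∀ (h : H) (v : V.V) (t : Finset ℕ) (v₀ : ℕ → V.V) (v₁ : ℕ → H),
    (∑ j ∈ t, v₀ j ⊗ₜ[k] v₁ j) = V.ρ v →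
    ρT (h ⊗ₜ[k] v) = ∑ j ∈ t, (h ⊗ₜ[k] v₀ j) ⊗ₜ[k] v₁ j

end CharProps

end RingPart

section CommPart

variable {k H : Type} [CommRing k] [CommRing H] [HopfAlgebra k H] (Sinv : H →ₗ[k] H)

/-- Characterizing property of the Yetter-Drinfeld coaction on `M ⊗_H N`:
`ρ(m ⊗ n) = m₀ ⊗ n₀ ⊗ n₁ m₁` (for `H` commutative). -/
def TensorCoactChar (A B : YDCat k H Sinv)
    (ρT : (A.M ⊗[H] B.M) →ₗ[k] (A.M ⊗[H] B.M) ⊗[k] H) : Prop :=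
  ∀ (m : A.M) (n : B.M) (s t : Finset ℕ) (m₀ : ℕ → A.M) (m₁ : ℕ → H)
    (n₀ : ℕ → B.M) (n₁ : ℕ → H),
    (∑ i ∈ s, m₀ i ⊗ₜ[k] m₁ i) = A.ρ m →
    (∑ j ∈ t, n₀ j ⊗ₜ[k] n₁ j) = B.ρ n →
    ρT (m ⊗ₜ[H] n) =
      ∑ i ∈ s, ∑ j ∈ t, (m₀ i ⊗ₜ[H] n₀ j) ⊗ₜ[k] (n₁ j * m₁ i)

/-- Restriction along `v ↦ 1 ⊗ v`, i.e. the canonical map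
`Hom_H(H ⊗ V, N) → Hom_k(V, N)`, `f ↦ (v ↦ f(1 ⊗ v))`. -/
def resUnitMap (V : Type) [AddCommGroup V] [Module k V] (N : Type) [AddCommGroup N]
    [Module k N] [Module H N] [IsScalarTower k H N] [SMulCommClass H k N] :
    ((H ⊗[k] V) →ₗ[H] N) →ₗ[k] (V →ₗ[k] N) where
  toFun f := (f.restrictScalars k).comp ((TensorProduct.mk k H V) 1)
  map_add' f g := by ext v; rfl
  map_smul' c f := by ext v; rfl

end CommPart

section Aux

variable {k H : Type} [CommRing k] [CommRing H] [HopfAlgebra k H]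
variable {R R' : Type} [CommRing R] [Algebra k R] [CommRing R'] [Algebra k R']
variable {X Y Z X' Y' Z' M : Type} [AddCommGroup X] [Module k X] [AddCommGroup Y] [Module k Y]
  [AddCommGroup Z] [Module k Z] [AddCommGroup X'] [Module k X'] [AddCommGroup Y'] [Module k Y']
  [AddCommGroup Z'] [Module k Z'] [AddCommGroup M] [Module k M]

/-- Base change to `R` of a bilinear map. -/
def bt (R : Type) [CommRing R] [Algebra k R] (β : X →ₗ[k] Y →ₗ[k] Z) :
    X ⊗[k] R →ₗ[k] Y ⊗[k] R →ₗ[k] Z ⊗[k] R :=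
  TensorProduct.map₂ β (LinearMap.mul k R)

@[simp] lemma bt_tmul (β : X →ₗ[k] Y →ₗ[k] Z) (x : X) (y : Y) (r s : R) :
    bt R β (x ⊗ₜ r) (y ⊗ₜ s) = β x y ⊗ₜ (r * s) := by
  simp [bt]

/-- The iterated coaction `m ⊗ h ↦ m₀ ⊗ (m₁ ⊗ h)`. -/
def rho2 (ρ : M →ₗ[k] M ⊗[k] H) : M ⊗[k] H →ₗ[k] M ⊗[k] (H ⊗[k] H) :=
  (TensorProduct.assoc k M H H).toLinearMap.comp (LinearMap.rTensor H ρ)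

@[simp] lemma rho2_tmul (ρ : M →ₗ[k] M ⊗[k] H) (m : M) (h : H) :
    rho2 ρ (m ⊗ₜ h) = (TensorProduct.assoc k M H H) (ρ m ⊗ₜ h) := by
  simp [rho2]

lemma rho2_bt {ρX : X →ₗ[k] X ⊗[k] H} {ρY : Y →ₗ[k] Y ⊗[k] H} {ρZ : Z →ₗ[k] Z ⊗[k] H}
    {β : X →ₗ[k] Y →ₗ[k] Z} (hc : ∀ x y, ρZ (β x y) = bt H β (ρX x) (ρY y))
    (U : X ⊗[k] H) (V : Y ⊗[k] H) :
    rho2 ρZ (bt H β U V) = bt (H ⊗[k] H) β (rho2 ρX U) (rho2 ρY V) := by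
  induction U using TensorProduct.induction_on with
  | zero => simp
  | add a b ha hb => simp only [map_add, LinearMap.add_apply, ha, hb]
  | tmul x h =>
  induction V using TensorProduct.induction_on with
  | zero => simp
  | add a b ha hb => simp only [map_add, ha, hb]
  | tmul y h' =>
  rw [bt_tmul, rho2_tmul, rho2_tmul, rho2_tmul, hc]
  generalize ρX x = A
  generalize ρY y = B
  induction A using TensorProduct.induction_on with
  | zero => simp
  | add a b ha hb => simp only [map_add, LinearMap.add_apply, TensorProduct.add_tmul, ha, hb]
  | tmul x' a =>
  induction B using TensorProduct.induction_on with
  | zero => simp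
  | add a b ha hb => simp only [map_add, TensorProduct.add_tmul, ha, hb]
  | tmul y' b => simp

lemma lT_bt (φ : R →ₐ[k] R') (β : X →ₗ[k] Y →ₗ[k] Z) (U : X ⊗[k] R) (V : Y ⊗[k] R) :
    LinearMap.lTensor Z φ.toLinearMap (bt R β U V) =
      bt R' β (LinearMap.lTensor X φ.toLinearMap U) (LinearMap.lTensor Y φ.toLinearMap V) := by
  induction U using TensorProduct.induction_on with
  | zero => simp
  | add a b ha hb => simp only [map_add, LinearMap.add_apply, ha, hb]
  | tmul x h =>
  induction V using TensorProduct.induction_on with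
  | zero => simp
  | add a b ha hb => simp only [map_add, ha, hb]
  | tmul y h' => simp

lemma rT_bt {β : X →ₗ[k] Y →ₗ[k] Z} {β' : X' →ₗ[k] Y' →ₗ[k] Z'} {f : X →ₗ[k] X'}
    {g : Y →ₗ[k] Y'} {l : Z →ₗ[k] Z'} (hh : ∀ x y, l (β x y) = β' (f x) (g y))
    (U : X ⊗[k] R) (V : Y ⊗[k] R) :
    LinearMap.rTensor R l (bt R β U V) =
      bt R β' (LinearMap.rTensor R f U) (LinearMap.rTensor R g V) := by
  induction U using TensorProduct.induction_on with
  | zero => simp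
  | add a b ha hb => simp only [map_add, LinearMap.add_apply, ha, hb]
  | tmul x h =>
  induction V using TensorProduct.induction_on with
  | zero => simp
  | add a b ha hb => simp only [map_add, ha, hb]
  | tmul y h' => simp [hh]

lemma bt_assoc {X₁ X₂ X₃ Y₁ Y₂ Z₁ : Type} [AddCommGroup X₁] [Module k X₁]
    [AddCommGroup X₂] [Module k X₂] [AddCommGroup X₃] [Module k X₃]
    [AddCommGroup Y₁] [Module k Y₁] [AddCommGroup Y₂] [Module k Y₂]
    [AddCommGroup Z₁] [Module k Z₁]
    {β₁ : Y₁ →ₗ[k] X₃ →ₗ[k] Z₁} {β₂ : X₁ →ₗ[k] X₂ →ₗ[k] Y₁}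
    {β₃ : X₁ →ₗ[k] Y₂ →ₗ[k] Z₁} {β₄ : X₂ →ₗ[k] X₃ →ₗ[k] Y₂}
    (hh : ∀ x y z, β₁ (β₂ x y) z = β₃ x (β₄ y z))
    (A : X₁ ⊗[k] R) (B : X₂ ⊗[k] R) (C : X₃ ⊗[k] R) :
    bt R β₁ (bt R β₂ A B) C = bt R β₃ A (bt R β₄ B C) := by
  induction A using TensorProduct.induction_on with
  | zero => simp
  | add a b ha hb => simp only [map_add, LinearMap.add_apply, ha, hb]
  | tmul x a =>
  induction B using TensorProduct.induction_on with
  | zero => simp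
  | add a b ha hb => simp only [map_add, LinearMap.add_apply, ha, hb]
  | tmul y b =>
  induction C using TensorProduct.induction_on with
  | zero => simp
  | add a b ha hb => simp only [map_add, ha, hb]
  | tmul z c => simp [hh, mul_assoc]

lemma bt_comm {X₁ X₂ X₃ Y₁ Y₂ Z₁ : Type} [AddCommGroup X₁] [Module k X₁]
    [AddCommGroup X₂] [Module k X₂] [AddCommGroup X₃] [Module k X₃]
    [AddCommGroup Y₁] [Module k Y₁] [AddCommGroup Y₂] [Module k Y₂]
    [AddCommGroup Z₁] [Module k Z₁]
    {β₁ : X₂ →ₗ[k] Y₁ →ₗ[k] Z₁} {β₂ : X₁ →ₗ[k] X₃ →ₗ[k] Y₁}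
    {β₃ : X₁ →ₗ[k] Y₂ →ₗ[k] Z₁} {β₄ : X₂ →ₗ[k] X₃ →ₗ[k] Y₂}
    (hh : ∀ x y z, β₁ y (β₂ x z) = β₃ x (β₄ y z))
    (A : X₁ ⊗[k] R) (B : X₂ ⊗[k] R) (C : X₃ ⊗[k] R) :
    bt R β₁ B (bt R β₂ A C) = bt R β₃ A (bt R β₄ B C) := by
  induction A using TensorProduct.induction_on with
  | zero => simp
  | add a b ha hb => simp only [map_add, LinearMap.add_apply, ha, hb]
  | tmul x a =>
  induction B using TensorProduct.induction_on with
  | zero => simp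
  | add a b ha hb => simp only [map_add, LinearMap.add_apply, ha, hb]
  | tmul y b =>
  induction C using TensorProduct.induction_on with
  | zero => simp
  | add a b ha hb => simp only [map_add, ha, hb]
  | tmul z c => simp [hh, mul_left_comm]

/-- Right multiplication by `r` on `M ⊗ R`, bilinear in `r`. -/
def rmul (M R : Type) [AddCommGroup M] [Module k M] [CommRing R] [Algebra k R] :
    R →ₗ[k] M ⊗[k] R →ₗ[k] M ⊗[k] R :=
  (LinearMap.lTensorHom M).comp (LinearMap.mul k R).flip

lemma rmul_eq (r : R) : rmul (k := k) M R r = LinearMap.lTensor M (LinearMap.mulRight k r) := by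
  ext; simp [rmul, mul_comm]

@[simp] lemma rmul_tmul (r s : R) (m : M) :
    rmul (k := k) M R r (m ⊗ₜ s) = m ⊗ₜ (s * r) := by
  simp [rmul, mul_comm]

lemma rmul_rmul (r s : R) (x : M ⊗[k] R) :
    rmul M R r (rmul M R s x) = rmul M R (s * r) x := by
  induction x using TensorProduct.induction_on with
  | zero => simp
  | add a b ha hb => simp only [map_add, ha, hb]
  | tmul y b => simp [mul_assoc]

lemma rmul_one (x : M ⊗[k] R) : rmul M R 1 x = x := by
  induction x using TensorProduct.induction_on with
  | zero => simp
  | add a b ha hb => simp only [map_add, ha, hb]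
  | tmul y b => simp

lemma rmul_algebraMap (c : k) (x : M ⊗[k] R) : rmul M R (algebraMap k R c) x = c • x := by
  rw [Algebra.algebraMap_eq_smul_one, map_smul, LinearMap.smul_apply, rmul_one]

lemma bt_rmul_right (β : X →ₗ[k] Y →ₗ[k] Z) (r : R) (U : X ⊗[k] R) (V : Y ⊗[k] R) :
    bt R β U (rmul Y R r V) = rmul Z R r (bt R β U V) := by
  induction U using TensorProduct.induction_on with
  | zero => simp
  | add a b ha hb => simp only [map_add, LinearMap.add_apply, ha, hb]
  | tmul x h =>
  induction V using TensorProduct.induction_on with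
  | zero => simp
  | add a b ha hb => simp only [map_add, ha, hb]
  | tmul y h' => simp [mul_assoc]

lemma comod_coassoc {ρ : M →ₗ[k] M ⊗[k] H} (hρ : IsComod k H ρ) (m : M) :
    rho2 ρ (ρ m) = LinearMap.lTensor M (Coalgebra.comul (R := k) (A := H)) (ρ m) := hρ.2 m

lemma comod_counit {ρ : M →ₗ[k] M ⊗[k] H} (hρ : IsComod k H ρ) (m : M) :
    LinearMap.lTensor M (Coalgebra.counit (R := k) (A := H)) (ρ m) = m ⊗ₜ (1 : k) := by
  apply (TensorProduct.rid k M).injective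
  rw [hρ.1 m]; simp

/-- If `K` is a linear map out of `M ⊗ H` which factors through `rho2`, with antipode-like
property, then `K (ρ m)` collapses. -/
lemma collapse {ρ : M →ₗ[k] M ⊗[k] H} (hρ : IsComod k H ρ)
    (K : M ⊗[k] H →ₗ[k] X) (K' : M ⊗[k] (H ⊗[k] H) →ₗ[k] X) (L : M →ₗ[k] X)
    (h1 : ∀ m h, K (m ⊗ₜ h) = K' (rho2 ρ (m ⊗ₜ h)))
    (h2 : ∀ m h, K' (m ⊗ₜ (Coalgebra.comul (R := k) h)) =
      Coalgebra.counit (R := k) h • L m) (m : M) : K (ρ m) = L m := by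
  have e1 : K = K'.comp (rho2 ρ) := TensorProduct.ext' h1
  have e2 : K'.comp (LinearMap.lTensor M (Coalgebra.comul (R := k) (A := H))) =
      (L.comp (TensorProduct.rid k M).toLinearMap).comp
        (LinearMap.lTensor M (Coalgebra.counit (R := k) (A := H))) :=
    TensorProduct.ext' fun m h => by simp [h2]
  rw [e1, LinearMap.comp_apply, comod_coassoc hρ, ← LinearMap.comp_apply, e2,
    LinearMap.comp_apply, comod_counit hρ]
  simp

lemma span_top {ρ : M →ₗ[k] M ⊗[k] H} (hρ : IsComod k H ρ) (φ : H →ₐ[k] R)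
    (W : Submodule k (M ⊗[k] R)) (hr : ∀ r : R, ∀ w ∈ W, rmul M R r w ∈ W)
    (hn : ∀ n, LinearMap.lTensor M φ.toLinearMap (ρ n) ∈ W) (x : M ⊗[k] R) : x ∈ W := by
  let K : M ⊗[k] H →ₗ[k] M ⊗[k] R := TensorProduct.lift
    ((((rmul M R).comp (φ.toLinearMap.comp (HopfAlgebra.antipode k))).flip).comp
      ((LinearMap.lTensor M φ.toLinearMap).comp ρ))
  let K' : M ⊗[k] (H ⊗[k] H) →ₗ[k] M ⊗[k] R := LinearMap.lTensor M
    (φ.toLinearMap.comp ((LinearMap.mul' k H).comp (LinearMap.lTensor H (HopfAlgebra.antipode k))))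
  have hK : ∀ m h, K (m ⊗ₜ h) =
      rmul M R (φ (HopfAlgebra.antipode k h)) (LinearMap.lTensor M φ.toLinearMap (ρ m)) := by
    intro m h; simp [K]
  have key : ∀ m, K (ρ m) = m ⊗ₜ (1 : R) := by
    apply collapse hρ K K' ((TensorProduct.mk k M R).flip 1)
    · intro m h
      rw [hK, rho2_tmul]
      generalize ρ m = A
      induction A using TensorProduct.induction_on with
      | zero => simp
      | add a b ha hb => simp only [map_add, TensorProduct.add_tmul, ha, hb]
      | tmul y b => simp [K']
    · intro m h
      simp [K', Algebra.algebraMap_eq_smul_one]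
  have hKW : ∀ y, K y ∈ W := by
    intro y
    induction y using TensorProduct.induction_on with
    | zero => simp
    | add a b ha hb => rw [map_add]; exact W.add_mem ha hb
    | tmul m h => rw [hK]; exact hr _ _ (hn m)
  induction x using TensorProduct.induction_on with
  | zero => simp
  | add a b ha hb => exact W.add_mem ha hb
  | tmul m r =>
    have := hr r _ (hKW (ρ m))
    rw [key] at this
    simpa using this

end Aux

section Aux2

variable {k H : Type} [CommRing k] [CommRing H] [HopfAlgebra k H]

lemma list_sum_range {α Q : Type} [AddCommMonoid Q] (d : α) (F : α → Q) (l : List α) :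
    ∑ i ∈ Finset.range l.length, F (l.getD i d) = (l.map F).sum := by
  induction l with
  | nil => simp
  | cons a l ih =>
    rw [List.length_cons, Finset.sum_range_succ', List.map_cons, List.sum_cons, add_comm]
    congr 1

lemma exists_rep2 {M N : Type} [AddCommGroup M] [Module k M] [AddCommGroup N] [Module k N]
    (x : M ⊗[k] N) : ∃ (t : Finset ℕ) (a : ℕ → M) (b : ℕ → N), ∑ i ∈ t, a i ⊗ₜ[k] b i = x := by
  have : ∃ l : List (M × N), (l.map (fun p => p.1 ⊗ₜ[k] p.2)).sum = x := by
    induction x using TensorProduct.induction_on with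
    | zero => exact ⟨[], rfl⟩
    | tmul a b => exact ⟨[(a, b)], by simp⟩
    | add x y hx hy =>
      obtain ⟨l, rfl⟩ := hx
      obtain ⟨l', rfl⟩ := hy
      exact ⟨l ++ l', by simp⟩
  obtain ⟨l, hl⟩ := this
  refine ⟨Finset.range l.length, fun i => (l.getD i (0, 0)).1, fun i => (l.getD i (0, 0)).2, ?_⟩
  rw [← hl]
  exact list_sum_range (0, 0) (fun p : M × N => p.1 ⊗ₜ[k] p.2) l

lemma exists_rep3 {M N L : Type} [AddCommGroup M] [Module k M] [AddCommGroup N] [Module k N]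
    [AddCommGroup L] [Module k L] (x : (M ⊗[k] N) ⊗[k] L) :
    ∃ (t : Finset ℕ) (a : ℕ → M) (b : ℕ → N) (c : ℕ → L),
      ∑ i ∈ t, (a i ⊗ₜ[k] b i) ⊗ₜ[k] c i = x := by
  have : ∃ l : List (M × N × L), (l.map (fun p => (p.1 ⊗ₜ[k] p.2.1) ⊗ₜ[k] p.2.2)).sum = x := by
    induction x using TensorProduct.induction_on with
    | zero => exact ⟨[], rfl⟩
    | tmul y c =>
      induction y using TensorProduct.induction_on with
      | zero => exact ⟨[], by simp⟩
      | tmul a b => exact ⟨[(a, b, c)], by simp⟩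
      | add x y hx hy =>
        obtain ⟨l, hl⟩ := hx
        obtain ⟨l', hl'⟩ := hy
        exact ⟨l ++ l', by simp [hl, hl', TensorProduct.add_tmul]⟩
    | add x y hx hy =>
      obtain ⟨l, rfl⟩ := hx
      obtain ⟨l', rfl⟩ := hy
      exact ⟨l ++ l', by simp⟩
  obtain ⟨l, hl⟩ := this
  refine ⟨Finset.range l.length, fun i => (l.getD i (0, 0, 0)).1,
    fun i => (l.getD i (0, 0, 0)).2.1, fun i => (l.getD i (0, 0, 0)).2.2, ?_⟩
  rw [← hl]
  exact list_sum_range (0, 0, 0) (fun p : M × N × L => (p.1 ⊗ₜ[k] p.2.1) ⊗ₜ[k] p.2.2) l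

/-- `(a ⊗ b) ⊗ c ↦ b ⊗ Sinv a * c`. -/
def cadL (Sinv : H →ₗ[k] H) : (H ⊗[k] H) ⊗[k] H →ₗ[k] H ⊗[k] H :=
  (LinearMap.lTensor H ((LinearMap.mul' k H).comp (LinearMap.rTensor H Sinv))).comp
    ((TensorProduct.leftComm k H H H).toLinearMap.comp (TensorProduct.assoc k H H H).toLinearMap)

lemma cadL_tmul (Sinv : H →ₗ[k] H) (a b c : H) :
    cadL Sinv ((a ⊗ₜ b) ⊗ₜ c) = b ⊗ₜ[k] (Sinv a * c) := by
  simp [cadL]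

/-- The coadjoint coaction `h ↦ h₂ ⊗ Sinv h₁ * h₃`. -/
def cad (Sinv : H →ₗ[k] H) : H →ₗ[k] H ⊗[k] H := (cadL Sinv).comp (Delta2 k H)

/-- The action as a bilinear map. -/
def actB (k H M : Type) [CommRing k] [CommRing H] [HopfAlgebra k H] [AddCommGroup M] [Module k M]
    [Module H M] [IsScalarTower k H M] : H →ₗ[k] M →ₗ[k] M :=
  LinearMap.mk₂ k (fun h m => h • m) (fun _ _ _ => add_smul _ _ _) (fun _ _ _ => smul_assoc _ _ _)
    (fun _ _ _ => smul_add _ _ _) (fun c h m => by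
      rw [← algebraMap_smul H c m, ← algebraMap_smul H c (h • m), smul_comm])

@[simp] lemma actB_apply {M : Type} [AddCommGroup M] [Module k M]
    [Module H M] [IsScalarTower k H M] (h : H) (m : M) : actB k H M h m = h • m := rfl

lemma compat_iff (Sinv : H →ₗ[k] H) {M : Type} [AddCommGroup M] [Module k M]
    [Module H M] [IsScalarTower k H M] (ρ : M →ₗ[k] M ⊗[k] H) :
    IsYDCompat k H Sinv ρ ↔ ∀ h m, ρ (h • m) = bt H (actB k H M) (cad Sinv h) (ρ m) := by
  have key : ∀ (h : H) (m : M) (s t : Finset ℕ) (a b c : ℕ → H) (m₀ : ℕ → M) (m₁ : ℕ → H),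
    (∑ i ∈ s, (a i ⊗ₜ[k] b i) ⊗ₜ[k] c i) = Delta2 k H h →
    (∑ j ∈ t, m₀ j ⊗ₜ[k] m₁ j) = ρ m →
    bt H (actB k H M) (cad Sinv h) (ρ m) =
      ∑ i ∈ s, ∑ j ∈ t, (b i • m₀ j) ⊗ₜ[k] (c i * m₁ j * Sinv (a i)) := by
    intro h m s t a b c m₀ m₁ h1 h2
    rw [cad, LinearMap.comp_apply, ← h1, ← h2]
    simp only [map_sum, LinearMap.sum_apply, cadL_tmul, bt_tmul, actB_apply]
    rw [Finset.sum_comm]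
    refine Finset.sum_congr rfl fun i _ => Finset.sum_congr rfl fun j _ => ?_
    congr 1
    ring
  constructor
  · intro hc h m
    obtain ⟨s, a, b, c, h1⟩ := exists_rep3 (Delta2 k H h)
    obtain ⟨t, m₀, m₁, h2⟩ := exists_rep2 (ρ m)
    rw [key h m s t a b c m₀ m₁ h1 h2, hc h m s t a b c m₀ m₁ h1 h2]
  · intro hc h m s t a b c m₀ m₁ h1 h2
    rw [hc, key h m s t a b c m₀ m₁ h1 h2]

lemma mul_Sinv (Sinv : H →ₗ[k] H)
    (hS1 : ∀ h : H, Sinv (HopfAlgebra.antipode (R := k) (A := H) h) = h)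
    (hS2 : ∀ h : H, HopfAlgebra.antipode (R := k) (A := H) (Sinv h) = h) (h : H) :
    LinearMap.mul' k H (LinearMap.lTensor H Sinv (Coalgebra.comul (R := k) h)) =
      algebraMap k H (Coalgebra.counit h) := by
  have hinj : Function.Injective (HopfAlgebra.antipode k (A := H)) :=
    Function.LeftInverse.injective hS1
  apply hinj
  have e : ((HopfAlgebra.antipode k (A := H)).comp (LinearMap.mul' k H)).comp
      (LinearMap.lTensor H Sinv) =
      (LinearMap.mul' k H).comp (LinearMap.rTensor H (HopfAlgebra.antipode k (A := H))) :=
    TensorProduct.ext' fun a b => by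
      simp [HopfAlgebra.antipode_mul_distrib, hS2]
  have e' := LinearMap.congr_fun e (Coalgebra.comul (R := k) h)
  simp only [LinearMap.comp_apply] at e'
  rw [e', HopfAlgebra.mul_antipode_rTensor_comul_apply, Algebra.algebraMap_eq_smul_one, map_smul,
    HopfAlgebra.antipode_one]

/-- `x ⊗ y ↦ (1 ⊗ Sinv x) * Δ y`. -/
lemma cad_eq (Sinv : H →ₗ[k] H) (h : H) :
    cad Sinv h = TensorProduct.lift (((rmul H H).comp Sinv).compl₂
      (Coalgebra.comul (R := k) (A := H))) (Coalgebra.comul (R := k) h) := by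
  let M3 : H ⊗[k] (H ⊗[k] H) →ₗ[k] H ⊗[k] H := TensorProduct.lift ((rmul H H).comp Sinv)
  have e1 : cadL Sinv = M3.comp (TensorProduct.assoc k H H H).toLinearMap := by
    apply TensorProduct.ext_threefold
    intro a b c
    simp [cadL_tmul, M3, mul_comm]
  have e2 : TensorProduct.lift (((rmul H H).comp Sinv).compl₂
      (Coalgebra.comul (R := k) (A := H))) = M3.comp (LinearMap.lTensor H Coalgebra.comul) :=
    TensorProduct.ext' fun a b => by simp [M3]
  rw [e2, cad, e1, Delta2]
  simp

/-- A submodule of `H ⊗ H` closed under right multiplication and containing the coadjoint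
coaction is everything. -/
lemma cad_span (Sinv : H →ₗ[k] H)
    (hS1 : ∀ h : H, Sinv (HopfAlgebra.antipode (R := k) (A := H) h) = h)
    (hS2 : ∀ h : H, HopfAlgebra.antipode (R := k) (A := H) (Sinv h) = h)
    (W : Submodule k (H ⊗[k] H)) (hr : ∀ r : H, ∀ w ∈ W, rmul H H r w ∈ W)
    (hc : ∀ h, cad Sinv h ∈ W) (x : H ⊗[k] H) : x ∈ W := by
  have hco : IsComod k H (Coalgebra.comul (R := k) (A := H)) := by
    constructor
    · intro m; simp
    · intro m; exact Coalgebra.coassoc_apply m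
  refine span_top hco (AlgHom.id k H) W hr (fun h => ?_) x
  have e0 : LinearMap.lTensor H (AlgHom.id k H).toLinearMap (Coalgebra.comul (R := k) h) =
      Coalgebra.comul (R := k) h := by
    change LinearMap.lTensor H (LinearMap.id) _ = _
    simp
  rw [e0]
  let K : H ⊗[k] H →ₗ[k] H ⊗[k] H := TensorProduct.lift ((rmul H H).compl₂ (cad Sinv))
  let T : H ⊗[k] H →ₗ[k] H ⊗[k] H := TensorProduct.lift (((rmul H H).comp Sinv).compl₂
      (Coalgebra.comul (R := k) (A := H)))
  let Q : H ⊗[k] (H ⊗[k] H) →ₗ[k] H ⊗[k] H := TensorProduct.lift ((rmul H H).compl₂ T)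
  have hKW : ∀ y, K y ∈ W := by
    intro y
    induction y using TensorProduct.induction_on with
    | zero => simp
    | add a b ha hb => rw [map_add]; exact W.add_mem ha hb
    | tmul m h => simpa [K] using hr _ _ (hc h)
  have e1 : K = Q.comp (LinearMap.lTensor H Coalgebra.comul) :=
    TensorProduct.ext' fun a b => by simp [K, Q, T, cad_eq]
  let Q' : H ⊗[k] H →ₗ[k] H ⊗[k] H := TensorProduct.lift
    (((rmul H H).comp ((LinearMap.mul' k H).comp (LinearMap.lTensor H Sinv))).compl₂
      (Coalgebra.comul (R := k) (A := H)) |>.comp (Coalgebra.comul (R := k) (A := H)))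
  have e2 : (Q.comp (TensorProduct.assoc k H H H).toLinearMap).comp
      (LinearMap.rTensor H Coalgebra.comul) = Q' := by
    apply TensorProduct.ext'
    intro a b
    simp only [Q', LinearMap.comp_apply, LinearMap.rTensor_tmul, TensorProduct.lift.tmul,
      LinearMap.compl₂_apply]
    generalize (Coalgebra.comul (R := k) a) = A
    induction A using TensorProduct.induction_on with
    | zero => simp
    | add a b ha hb => simp only [map_add, TensorProduct.add_tmul, LinearMap.add_apply, ha, hb]
    | tmul x y => simp [Q, T, rmul_rmul, mul_comm]
  have e3 : Q' = (Coalgebra.comul (R := k) (A := H)).comp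
      ((TensorProduct.lid k H).toLinearMap.comp (LinearMap.rTensor H Coalgebra.counit)) := by
    apply TensorProduct.ext'
    intro a b
    simp [Q', mul_Sinv Sinv hS1 hS2, rmul_algebraMap]
  have : K (Coalgebra.comul (R := k) h) = Coalgebra.comul (R := k) h := by
    rw [e1, LinearMap.comp_apply, ← Coalgebra.coassoc_apply]
    have := LinearMap.congr_fun (e2.trans e3) (Coalgebra.comul (R := k) h)
    simpa using this
  rw [← this]
  exact hKW _

end Aux2

section Aux3

variable {k H : Type} [CommRing k] [CommRing H] [HopfAlgebra k H] {Sinv : H →ₗ[k] H}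
variable {R : Type} [CommRing R] [Algebra k R]

/-- Evaluation as a bilinear map. -/
def evB (N P : YDCat k H Sinv) : (N.M →ₗ[H] P.M) →ₗ[k] N.M →ₗ[k] P.M where
  toFun f := f.restrictScalars k
  map_add' _ _ := rfl
  map_smul' _ _ := rfl

@[simp] lemma evB_apply (N P : YDCat k H Sinv) (f : N.M →ₗ[H] P.M) (n : N.M) :
    evB N P f n = f n := rfl

lemma bt_evB_tmul (N P : YDCat k H Sinv) (U : (N.M →ₗ[H] P.M) ⊗[k] R) (n : N.M) (r : R) :
    bt R (evB N P) U (n ⊗ₜ r) = rmul P.M R r (LinearMap.rTensor R (evalAtH (N := P.M) n) U) := by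
  induction U using TensorProduct.induction_on with
  | zero => simp
  | add a b ha hb => simp only [map_add, LinearMap.add_apply, ha, hb]
  | tmul x y => simp [evalAtH]

lemma dual_basis (N : YDCat k H Sinv) [Module.Finite H N.M] [Module.Projective H N.M] :
    ∃ (n : ℕ) (e : Fin n → N.M) (φ : Fin n → N.M →ₗ[H] H), ∀ x, ∑ i, φ i x • e i = x := by
  obtain ⟨n, f, g, -, -, hfg⟩ := Module.Finite.exists_comp_eq_id_of_projective H N.M
  refine ⟨n, fun i => f (Pi.single i 1), fun i => (LinearMap.proj i).comp g, fun x => ?_⟩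
  have h1 := LinearMap.congr_fun hfg x
  simp only [LinearMap.comp_apply, LinearMap.id_apply] at h1
  conv_rhs => rw [← h1, ← Finset.univ_sum_single (g x), map_sum]
  refine Finset.sum_congr rfl fun i _ => ?_
  simp only [LinearMap.comp_apply, LinearMap.proj_apply, ← map_smul]
  congr 1
  rw [← Pi.single_smul]
  simp

/-- `p ↦ φ(·) p`. -/
def smR (N P : YDCat k H Sinv) (φ : N.M →ₗ[H] H) : P.M →ₗ[k] (N.M →ₗ[H] P.M) where
  toFun p := φ.smulRight p
  map_add' p q := by ext x; simp
  map_smul' c p := by ext x; exact smul_comm _ _ _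

lemma ev_inj (N P : YDCat k H Sinv) [Module.Finite H N.M] [Module.Projective H N.M]
    (U : (N.M →ₗ[H] P.M) ⊗[k] R)
    (h : ∀ n, LinearMap.rTensor R (evalAtH (N := P.M) n) U = 0) : U = 0 := by
  obtain ⟨n, e, φ, he⟩ := dual_basis N
  have : ∑ i, LinearMap.rTensor R (smR N P (φ i))
      (LinearMap.rTensor R (evalAtH (N := P.M) (e i)) U) = U := by
    clear h
    induction U using TensorProduct.induction_on with
    | zero => simp
    | add a b ha hb => simp only [map_add, Finset.sum_add_distrib, ha, hb]
    | tmul f r =>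
      simp only [LinearMap.rTensor_tmul, ← TensorProduct.sum_tmul]
      congr 1
      ext x
      conv_rhs => rw [← he x]
      simp [smR, evalAtH]
  rw [← this]
  simp [h]

lemma hom_ext (N P : YDCat k H Sinv) [Module.Finite H N.M] [Module.Projective H N.M]
    (φ : H →ₐ[k] R) (U V : (N.M →ₗ[H] P.M) ⊗[k] R)
    (h : ∀ n, bt R (evB N P) U (LinearMap.lTensor N.M φ.toLinearMap (N.ρ n)) =
      bt R (evB N P) V (LinearMap.lTensor N.M φ.toLinearMap (N.ρ n))) : U = V := by
  rw [← sub_eq_zero]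
  apply ev_inj
  intro n
  let W : Submodule k (N.M ⊗[k] R) := LinearMap.ker (bt R (evB N P) (U - V))
  have hW := span_top N.comod φ W (fun r w hw => by
      simp only [W, LinearMap.mem_ker] at hw ⊢
      rw [bt_rmul_right, hw, map_zero]) (fun n => by
      simp only [W, LinearMap.mem_ker]
      rw [map_sub, LinearMap.sub_apply, h, sub_self]) (n ⊗ₜ 1)
  simp only [W, LinearMap.mem_ker] at hW
  rwa [bt_evB_tmul, rmul_one] at hW

lemma lT_id {M : Type} [AddCommGroup M] [Module k M] (x : M ⊗[k] H) :
    LinearMap.lTensor M (AlgHom.id k H).toLinearMap x = x := by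
  change LinearMap.lTensor M LinearMap.id x = x
  simp

lemma hom_ext' (N P : YDCat k H Sinv) [Module.Finite H N.M] [Module.Projective H N.M]
    (U V : (N.M →ₗ[H] P.M) ⊗[k] H)
    (h : ∀ n, bt H (evB N P) U (N.ρ n) = bt H (evB N P) V (N.ρ n)) : U = V :=
  hom_ext N P (AlgHom.id k H) U V fun n => by rw [lT_id, h]

/-- `n ⊗ h ↦ ρ (f n) * S h`. -/
def GG (N P : YDCat k H Sinv) (f : N.M →ₗ[H] P.M) : N.M ⊗[k] H →ₗ[k] P.M ⊗[k] H :=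
  TensorProduct.lift ((((rmul P.M H).comp (HopfAlgebra.antipode k)).flip).comp
      (P.ρ.comp (evB N P f)))

lemma GG_tmul (N P : YDCat k H Sinv) (f : N.M →ₗ[H] P.M) (n : N.M) (h : H) :
    GG N P f (n ⊗ₜ h) = rmul P.M H (HopfAlgebra.antipode k h) (P.ρ (f n)) := by
  simp [GG]

/-- `n ↦ ρ (f n₀) * S n₁`. -/
def FF (N P : YDCat k H Sinv) : (N.M →ₗ[H] P.M) →ₗ[k] N.M →ₗ[k] P.M ⊗[k] H where
  toFun f := (GG N P f).comp N.ρ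
  map_add' f g := by
    rw [← LinearMap.add_comp]; congr 1
    exact TensorProduct.ext' fun n h => by simp [GG_tmul]
  map_smul' c f := by
    rw [RingHom.id_apply, ← LinearMap.smul_comp]; congr 1
    exact TensorProduct.ext' fun n h => by simp [GG_tmul]

/-- The right `H`-linear extension of `FF`. -/
def Fhat (N P : YDCat k H Sinv) (f : N.M →ₗ[H] P.M) : N.M ⊗[k] H →ₗ[k] P.M ⊗[k] H :=
  TensorProduct.lift ((rmul P.M H).flip.comp (FF N P f))

lemma Fhat_tmul (N P : YDCat k H Sinv) (f : N.M →ₗ[H] P.M) (n : N.M) (h : H) :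
    Fhat N P f (n ⊗ₜ h) = rmul P.M H h (FF N P f n) := by
  simp [Fhat]

lemma Fhat_rmul (N P : YDCat k H Sinv) (f : N.M →ₗ[H] P.M) (r : H) (x : N.M ⊗[k] H) :
    Fhat N P f (rmul N.M H r x) = rmul P.M H r (Fhat N P f x) := by
  induction x using TensorProduct.induction_on with
  | zero => simp
  | add a b ha hb => simp only [map_add, ha, hb]
  | tmul x y => rw [rmul_tmul, Fhat_tmul, Fhat_tmul, rmul_rmul]

lemma Fhat_rho (N P : YDCat k H Sinv) (f : N.M →ₗ[H] P.M) (n : N.M) :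
    Fhat N P f (N.ρ n) = P.ρ (f n) := by
  let K' : N.M ⊗[k] (H ⊗[k] H) →ₗ[k] P.M ⊗[k] H := TensorProduct.lift
    ((((rmul P.M H).comp ((LinearMap.mul' k H).comp
      (LinearMap.rTensor H (HopfAlgebra.antipode k)))).flip).comp (P.ρ.comp (evB N P f)))
  refine collapse N.comod (Fhat N P f) K' (P.ρ.comp (evB N P f)) ?_ ?_ n
  · intro m h
    rw [Fhat_tmul, rho2_tmul]
    change rmul P.M H h (GG N P f (N.ρ m)) = _
    generalize N.ρ m = A
    induction A using TensorProduct.induction_on with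
    | zero => simp
    | add a b ha hb => simp only [map_add, TensorProduct.add_tmul, ha, hb]
    | tmul y b => simp [K', GG_tmul, rmul_rmul]
  · intro m h
    simp [K', rmul_algebraMap]

lemma bt_act_rmul {M : Type} [AddCommGroup M] [Module k M]
    [Module H M] [IsScalarTower k H M] (r : H) (Y : H ⊗[k] H) (Z : M ⊗[k] H) :
    bt H (actB k H M) (rmul H H r Y) Z = rmul M H r (bt H (actB k H M) Y Z) := by
  induction Y using TensorProduct.induction_on with
  | zero => simp
  | add a b ha hb => simp only [map_add, LinearMap.add_apply, ha, hb]
  | tmul x h =>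
  induction Z using TensorProduct.induction_on with
  | zero => simp
  | add a b ha hb => simp only [map_add, ha, hb]
  | tmul y h' => simp [mul_assoc, mul_comm, mul_left_comm]

lemma Fhat_act (hS1 : ∀ h : H, Sinv (HopfAlgebra.antipode (R := k) (A := H) h) = h)
    (hS2 : ∀ h : H, HopfAlgebra.antipode (R := k) (A := H) (Sinv h) = h)
    (N P : YDCat k H Sinv) (f : N.M →ₗ[H] P.M) (Y : H ⊗[k] H) (Z : N.M ⊗[k] H) :
    Fhat N P f (bt H (actB k H N.M) Y Z) = bt H (actB k H P.M) Y (Fhat N P f Z) := by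
  let W : Submodule k (H ⊗[k] H) :=
    LinearMap.ker ((bt H (actB k H N.M)).compr₂ (Fhat N P f) -
      (bt H (actB k H P.M)).compl₂ (Fhat N P f))
  have hW : ∀ Y, Y ∈ W ↔ ∀ Z, Fhat N P f (bt H (actB k H N.M) Y Z) =
      bt H (actB k H P.M) Y (Fhat N P f Z) := by
    intro Y
    rw [LinearMap.mem_ker, LinearMap.sub_apply, sub_eq_zero]
    constructor
    · intro h Z
      exact LinearMap.congr_fun h Z
    · intro h
      exact LinearMap.ext h
  refine (hW Y).1 (cad_span Sinv hS1 hS2 W ?_ ?_ Y) Z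
  · intro r w hw
    rw [hW] at hw ⊢
    intro Z
    rw [bt_act_rmul, Fhat_rmul, hw, bt_act_rmul]
  · intro h
    rw [hW]
    intro Z
    let W' : Submodule k (N.M ⊗[k] H) := LinearMap.ker
      ((Fhat N P f).comp (bt H (actB k H N.M) (cad Sinv h)) -
        (bt H (actB k H P.M) (cad Sinv h)).comp (Fhat N P f))
    have hW' : ∀ Z, Z ∈ W' ↔ Fhat N P f (bt H (actB k H N.M) (cad Sinv h) Z) =
      bt H (actB k H P.M) (cad Sinv h) (Fhat N P f Z) := by
      intro Z
      rw [LinearMap.mem_ker, LinearMap.sub_apply, sub_eq_zero]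
      rfl
    refine (hW' Z).1 (span_top N.comod (AlgHom.id k H) W' ?_ ?_ Z)
    · intro r w hw
      rw [hW'] at hw ⊢
      rw [bt_rmul_right, Fhat_rmul, hw, Fhat_rmul, bt_rmul_right]
    · intro n
      rw [hW', lT_id, ← (compat_iff Sinv N.ρ).1 N.compat, Fhat_rho, Fhat_rho, map_smul,
        (compat_iff Sinv P.ρ).1 P.compat]

lemma FF_smul (hS1 : ∀ h : H, Sinv (HopfAlgebra.antipode (R := k) (A := H) h) = h)
    (hS2 : ∀ h : H, HopfAlgebra.antipode (R := k) (A := H) (Sinv h) = h)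
    (N P : YDCat k H Sinv) (f : N.M →ₗ[H] P.M) (h : H) (n : N.M) :
    FF N P f (h • n) = LinearMap.rTensor H (actB k H P.M h) (FF N P f n) := by
  have := Fhat_act hS1 hS2 N P f (h ⊗ₜ 1) (n ⊗ₜ 1)
  rw [bt_tmul, Fhat_tmul, Fhat_tmul, mul_one, rmul_one, rmul_one, actB_apply] at this
  rw [this]
  generalize FF N P f n = A
  induction A using TensorProduct.induction_on with
  | zero => simp
  | add a b ha hb => simp only [map_add, ha, hb]
  | tmul y b => simp

/-- Covariance of evaluation. -/
def EvCov (N P : YDCat k H Sinv)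
    (ρQ : (N.M →ₗ[H] P.M) →ₗ[k] (N.M →ₗ[H] P.M) ⊗[k] H) : Prop :=
  ∀ f n, P.ρ (f n) = bt H (evB N P) (ρQ f) (N.ρ n)

lemma evCov_of (N P : YDCat k H Sinv)
    (ρQ : (N.M →ₗ[H] P.M) →ₗ[k] (N.M →ₗ[H] P.M) ⊗[k] H)
    (h : ∀ f n, LinearMap.rTensor H (evalAtH (N := P.M) n) (ρQ f) = FF N P f n) :
    EvCov N P ρQ := by
  intro f n
  rw [← Fhat_rho]
  have : Fhat N P f = bt H (evB N P) (ρQ f) :=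
    TensorProduct.ext' fun n x => by rw [Fhat_tmul, bt_evB_tmul, h]
  rw [this]

lemma evCov_of_char (N P : YDCat k H Sinv)
    (ρQ : (N.M →ₗ[H] P.M) →ₗ[k] (N.M →ₗ[H] P.M) ⊗[k] H)
    (h : HomCoactChar Sinv N P ρQ) : EvCov N P ρQ := by
  apply evCov_of
  intro f n
  obtain ⟨t, n₀, n₁, ht⟩ := exists_rep2 (N.ρ n)
  rw [h f n t n₀ n₁ ht]
  change _ = GG N P f (N.ρ n)
  rw [← ht, map_sum]
  exact Finset.sum_congr rfl fun j _ => by rw [GG_tmul, rmul_eq]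

lemma exists_evCov (hS1 : ∀ h : H, Sinv (HopfAlgebra.antipode (R := k) (A := H) h) = h)
    (hS2 : ∀ h : H, HopfAlgebra.antipode (R := k) (A := H) (Sinv h) = h)
    (N P : YDCat k H Sinv) [Module.Finite H N.M] [Module.Projective H N.M] :
    ∃ ρQ, EvCov N P ρQ := by
  obtain ⟨n, e, φ, he⟩ := dual_basis N
  refine ⟨∑ i, (LinearMap.rTensor H (smR N P (φ i))).comp ((FF N P).flip (e i)), ?_⟩
  apply evCov_of
  intro f x
  conv_rhs => rw [← he x, map_sum]
  rw [LinearMap.sum_apply, map_sum]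
  refine Finset.sum_congr rfl fun i _ => ?_
  rw [FF_smul hS1 hS2, LinearMap.comp_apply, LinearMap.flip_apply, ← LinearMap.rTensor_comp_apply]
  congr 1

lemma evCov_comod (N P : YDCat k H Sinv) [Module.Finite H N.M] [Module.Projective H N.M]
    (ρQ : (N.M →ₗ[H] P.M) →ₗ[k] (N.M →ₗ[H] P.M) ⊗[k] H) (h : EvCov N P ρQ) :
    IsComod k H ρQ := by
  have hε : (Bialgebra.counitAlgHom k H).toLinearMap = Coalgebra.counit := rfl
  have hΔ : (Bialgebra.comulAlgHom k H).toLinearMap = Coalgebra.comul := rfl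
  constructor
  · intro f
    have : LinearMap.lTensor _ (Coalgebra.counit (R := k) (A := H)) (ρQ f) = f ⊗ₜ (1 : k) := by
      apply hom_ext N P (Bialgebra.counitAlgHom k H)
      intro n
      rw [← hε, ← lT_bt, ← h, hε, comod_counit P.comod, comod_counit N.comod]
      simp
    rw [this]; simp
  · intro f
    change rho2 ρQ (ρQ f) = _
    apply hom_ext N P (Bialgebra.comulAlgHom k H)
    intro n
    conv_rhs => rw [← hΔ, ← lT_bt, ← h, hΔ, ← comod_coassoc P.comod]
    rw [hΔ, ← comod_coassoc N.comod, h]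
    exact (rho2_bt (β := evB N P) (fun f n => h f n) _ _).symm

lemma evCov_compat (N P : YDCat k H Sinv) [Module.Finite H N.M] [Module.Projective H N.M]
    (ρQ : (N.M →ₗ[H] P.M) →ₗ[k] (N.M →ₗ[H] P.M) ⊗[k] H) (h : EvCov N P ρQ) :
    IsYDCompat k H Sinv ρQ := by
  rw [compat_iff]
  intro x f
  apply hom_ext'
  intro n
  rw [← h, LinearMap.smul_apply, (compat_iff Sinv P.ρ).1 P.compat, h]
  symm
  apply bt_assoc
  intro x y z
  rfl

end Aux3

section Aux4

variable {k H : Type} [CommRing k] [CommRing H] [HopfAlgebra k H] {Sinv : H →ₗ[k] H}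

/-- The canonical map `A × N → A ⊗_H N` as a `k`-bilinear map. -/
def muB (A N : YDCat k H Sinv) : A.M →ₗ[k] N.M →ₗ[k] A.M ⊗[H] N.M :=
  LinearMap.mk₂ k (fun a n => a ⊗ₜ[H] n) (fun _ _ _ => TensorProduct.add_tmul _ _ _)
    (fun _ _ _ => rfl) (fun _ _ _ => TensorProduct.tmul_add _ _ _)
    (fun c a n => by
      rw [← algebraMap_smul H c n, TensorProduct.tmul_smul, algebraMap_smul])

@[simp] lemma muB_apply (A N : YDCat k H Sinv) (a : A.M) (n : N.M) :
    muB A N a n = a ⊗ₜ[H] n := rfl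

lemma muB_balanced (A N : YDCat k H Sinv) (h : H) (a : A.M) (n : N.M) :
    bt H (muB A N) (A.ρ (h • a)) (N.ρ n) = bt H (muB A N) (A.ρ a) (N.ρ (h • n)) := by
  rw [(compat_iff Sinv A.ρ).1 A.compat, (compat_iff Sinv N.ρ).1 N.compat]
  rw [bt_assoc (β₃ := actB k H (A.M ⊗[H] N.M)) (β₄ := muB A N) (fun x y z => rfl)]
  rw [bt_comm (β₃ := actB k H (A.M ⊗[H] N.M)) (β₄ := muB A N)
    (fun x y z => by simp)]

/-- The coaction on `A ⊗_H N`. -/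
def rhoT (A N : YDCat k H Sinv) :
    (A.M ⊗[H] N.M) →ₗ[k] (A.M ⊗[H] N.M) ⊗[k] H :=
  let F : (A.M ⊗[H] N.M) →+ (A.M ⊗[H] N.M) ⊗[k] H := TensorProduct.liftAddHom
    (AddMonoidHom.mk' (fun a => AddMonoidHom.mk' (fun n => bt H (muB A N) (A.ρ a) (N.ρ n))
      (fun x y => by simp)) (fun x y => by ext; simp))
    (fun h a n => muB_balanced A N h a n)
  { toFun := F
    map_add' := F.map_add
    map_smul' := fun c x => by
      induction x using TensorProduct.induction_on with
      | zero => simp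
      | add a b ha hb => rw [smul_add, map_add, ha, hb, map_add, smul_add]
      | tmul a n =>
        change bt H (muB A N) (A.ρ (c • a)) (N.ρ n) = c • bt H (muB A N) (A.ρ a) (N.ρ n)
        simp }

lemma rhoT_tmul (A N : YDCat k H Sinv) (a : A.M) (n : N.M) :
    rhoT A N (a ⊗ₜ n) = bt H (muB A N) (A.ρ a) (N.ρ n) := rfl

lemma rhoT_comod (A N : YDCat k H Sinv) : IsComod k H (rhoT A N) := by
  have hε : (Bialgebra.counitAlgHom k H).toLinearMap = Coalgebra.counit := rfl
  have hΔ : (Bialgebra.comulAlgHom k H).toLinearMap = Coalgebra.comul := rfl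
  constructor
  · intro x
    induction x using TensorProduct.induction_on with
    | zero => simp
    | add a b ha hb => simp only [map_add, ha, hb]
    | tmul a n =>
      rw [rhoT_tmul, ← hε, lT_bt, hε, comod_counit A.comod, comod_counit N.comod]
      simp
  · intro x
    induction x using TensorProduct.induction_on with
    | zero => simp
    | add a b ha hb => simp only [map_add, ha, hb]
    | tmul a n =>
      change rho2 (rhoT A N) (rhoT A N (a ⊗ₜ n)) = _
      rw [rhoT_tmul, ← hΔ, lT_bt, hΔ, ← comod_coassoc A.comod, ← comod_coassoc N.comod]
      exact rho2_bt (β := muB A N) (fun a n => rhoT_tmul A N a n) _ _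

lemma rhoT_compat (A N : YDCat k H Sinv) : IsYDCompat k H Sinv (rhoT A N) := by
  rw [compat_iff]
  intro h x
  induction x using TensorProduct.induction_on with
  | zero => simp
  | add a b ha hb => rw [smul_add, map_add, ha, hb, map_add, map_add]
  | tmul a n =>
    rw [TensorProduct.smul_tmul', rhoT_tmul, (compat_iff Sinv A.ρ).1 A.compat, rhoT_tmul]
    exact bt_assoc (fun x y z => rfl) _ _ _

/-- The Yetter-Drinfeld module `A ⊗_H N`. -/
def tens (A N : YDCat k H Sinv) : YDCat k H Sinv :=
  YDCat.mk (M := A.M ⊗[H] N.M) (rhoT A N) (rhoT_comod A N) (rhoT_compat A N)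

/-- `Hom_H(N, P)` with a covariant coaction. -/
def homObj (N P : YDCat k H Sinv) [Module.Finite H N.M] [Module.Projective H N.M]
    (ρQ : (N.M →ₗ[H] P.M) →ₗ[k] (N.M →ₗ[H] P.M) ⊗[k] H) (h : EvCov N P ρQ) : YDCat k H Sinv :=
  YDCat.mk (M := N.M →ₗ[H] P.M) ρQ (evCov_comod N P ρQ h) (evCov_compat N P ρQ h)

/-- The `H`-linear map underlying a morphism. -/
def toHLin {A B : YDCat k H Sinv} (f : A.M →ₗ[k] B.M) (hf : IsHom k H A.ρ B.ρ f) :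
    A.M →ₗ[H] B.M where
  toFun := f
  map_add' := f.map_add
  map_smul' := hf.1

lemma homObj_injective (N I : YDCat k H Sinv) [Module.Finite H N.M] [Module.Projective H N.M]
    (ρQ : (N.M →ₗ[H] I.M) →ₗ[k] (N.M →ₗ[H] I.M) ⊗[k] H) (h : EvCov N I ρQ)
    (hI : IsInjectiveYD k H Sinv I) : IsInjectiveYD k H Sinv (homObj N I ρQ h) := by
  intro A B ι f hι hinj hf
  replace hf : IsHom k H A.ρ ρQ f := hf
  change A.M →ₗ[k] (N.M →ₗ[H] I.M) at f
  let fH : A.M →ₗ[H] (N.M →ₗ[H] I.M) :=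
    { toFun := f, map_add' := f.map_add, map_smul' := hf.1 }
  let f' : (A.M ⊗[H] N.M) →ₗ[H] I.M := TensorProduct.lift fH
  let ι' : (A.M ⊗[H] N.M) →ₗ[H] (B.M ⊗[H] N.M) := LinearMap.rTensor N.M (toHLin ι hι)
  have hι' : Function.Injective ι' :=
    Module.Flat.rTensor_preserves_injective_linearMap (toHLin ι hι) hinj
  have hιhom : IsHom k H (rhoT A N) (rhoT B N) (ι'.restrictScalars k) := by
    refine ⟨fun h x => map_smul ι' h x, ?_⟩
    ext x
    simp only [LinearMap.comp_apply, LinearMap.restrictScalars_apply]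
    induction x using TensorProduct.induction_on with
    | zero => simp
    | add a b ha hb => simp only [map_add, ha, hb]
    | tmul a n =>
      have e : ι' (a ⊗ₜ n) = ι a ⊗ₜ n := rfl
      have e2 := LinearMap.congr_fun hι.2 a
      simp only [LinearMap.comp_apply] at e2
      rw [e, rhoT_tmul, rhoT_tmul, e2]
      rw [rT_bt (β' := muB B N) (f := ι) (g := LinearMap.id) (fun x y => rfl)]
      simp
  have hfhom : IsHom k H (rhoT A N) I.ρ (f'.restrictScalars k) := by
    refine ⟨fun h x => map_smul f' h x, ?_⟩
    ext x
    simp only [LinearMap.comp_apply, LinearMap.restrictScalars_apply]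
    induction x using TensorProduct.induction_on with
    | zero => simp
    | add a b ha hb => simp only [map_add, ha, hb]
    | tmul a n =>
      have e : f' (a ⊗ₜ n) = f a n := rfl
      have e2 := LinearMap.congr_fun hf.2 a
      simp only [LinearMap.comp_apply] at e2
      rw [e, rhoT_tmul, h, e2]
      rw [rT_bt (β' := evB N I) (f := f) (g := LinearMap.id) (fun x y => rfl)]
      simp
  obtain ⟨g, hg, hgf⟩ := hI (tens A N) (tens B N) (ι'.restrictScalars k) (f'.restrictScalars k)
    hιhom hι' hfhom
  change (B.M ⊗[H] N.M) →ₗ[k] I.M at g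
  replace hg : IsHom k H (rhoT B N) I.ρ g := hg
  let G : B.M →ₗ[k] (N.M →ₗ[H] I.M) :=
    { toFun := fun b =>
        { toFun := fun n => g (b ⊗ₜ[H] n)
          map_add' := fun x y => by rw [TensorProduct.tmul_add, map_add]
          map_smul' := fun c x => by rw [TensorProduct.tmul_smul, hg.1]; rfl }
      map_add' := fun x y => by ext n; simp [TensorProduct.add_tmul]
      map_smul' := fun c x => by ext n; simp [← TensorProduct.smul_tmul'] }
  have hG : ∀ b n, G b n = g (b ⊗ₜ[H] n) := fun _ _ => rfl
  refine ⟨G, ⟨fun x b => ?_, ?_⟩, ?_⟩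
  · apply LinearMap.ext
    intro n
    change g ((x • b) ⊗ₜ[H] n) = x • g (b ⊗ₜ[H] n)
    rw [← TensorProduct.smul_tmul', hg.1]
  · apply LinearMap.ext
    intro b
    change ρQ (G b) = LinearMap.rTensor H G (B.ρ b)
    apply hom_ext'
    intro n
    have e2 := LinearMap.congr_fun hg.2 (b ⊗ₜ n)
    simp only [LinearMap.comp_apply] at e2
    rw [← h, hG, e2, rhoT_tmul,
      rT_bt (β' := evB N I) (f := G) (g := LinearMap.id) (fun x y => rfl)]
    simp
  · apply LinearMap.ext
    intro a
    apply LinearMap.ext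
    intro n
    exact LinearMap.congr_fun hgf (a ⊗ₜ n)

lemma post_hom (N P P' : YDCat k H Sinv) [Module.Finite H N.M] [Module.Projective H N.M]
    (ρQ : (N.M →ₗ[H] P.M) →ₗ[k] (N.M →ₗ[H] P.M) ⊗[k] H) (h : EvCov N P ρQ)
    (ρQ' : (N.M →ₗ[H] P'.M) →ₗ[k] (N.M →ₗ[H] P'.M) ⊗[k] H) (h' : EvCov N P' ρQ')
    (f : P.M →ₗ[k] P'.M) (hf : IsHom k H P.ρ P'.ρ f) :
    IsHom k H ρQ ρQ' (postcompH (X := N.M) f hf.1) := by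
  refine ⟨fun x u => ?_, ?_⟩
  · ext n
    exact hf.1 x (u n)
  · apply LinearMap.ext
    intro u
    apply hom_ext'
    intro n
    have e2 := LinearMap.congr_fun hf.2 (u n)
    simp only [LinearMap.comp_apply] at e2 ⊢
    rw [← h']
    change P'.ρ (f (u n)) = _
    rw [e2, h, rT_bt (β' := evB N P') (f := postcompH (X := N.M) f hf.1)
      (g := LinearMap.id) (fun x y => rfl)]
    simp

lemma post_exact (N A B C : YDCat k H Sinv) [Module.Projective H N.M]
    (f : A.M →ₗ[k] B.M) (g : B.M →ₗ[k] C.M)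
    (hf : IsHom k H A.ρ B.ρ f) (hg : IsHom k H B.ρ C.ρ g)
    (hfg : LinearMap.range f = LinearMap.ker g) :
    LinearMap.range (postcompH (X := N.M) f hf.1) =
      LinearMap.ker (postcompH (X := N.M) g hg.1) := by
  apply le_antisymm
  · rintro _ ⟨u, rfl⟩
    rw [LinearMap.mem_ker]
    ext n
    have : f (u n) ∈ LinearMap.ker g := hfg ▸ LinearMap.mem_range_self f _
    exact this
  · intro u hu
    have hu' : ∀ n, u n ∈ LinearMap.range (toHLin f hf) := by
      intro n
      have h1 : u n ∈ LinearMap.ker g := LinearMap.congr_fun (LinearMap.mem_ker.1 hu) n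
      rw [← hfg] at h1
      obtain ⟨a, ha⟩ := h1
      exact ⟨a, ha⟩
    obtain ⟨v, hv⟩ := Module.projective_lifting_property (toHLin f hf).rangeRestrict
      (u.codRestrict _ hu') (LinearMap.surjective_rangeRestrict _)
    refine ⟨v, ?_⟩
    ext n
    exact congrArg Subtype.val (LinearMap.congr_fun hv n)

end Aux4


/-- Corollary 2.3(2). Let `k` be a field, `H` a commutative Hopf
algebra over `k` with bijective antipode, and `N`, `P` Yetter-Drinfeld modules with
`N` finitely generated projective as a left `H`-module. Then the injective
dimension of `Hom_H(N, P)` in the category of Yetter-Drinfeld modules is at most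
the injective dimension of `P`. -/
theorem injdim_homH_le
    (k H : Type) [Field k] [CommRing H] [HopfAlgebra k H]
    (Sinv : H →ₗ[k] H)
    (hS1 : ∀ h : H, Sinv (HopfAlgebra.antipode (R := k) (A := H) h) = h)
    (hS2 : ∀ h : H, HopfAlgebra.antipode (R := k) (A := H) (Sinv h) = h)
    (N P : YDCat k H Sinv)
    (hNfin : Module.Finite H N.M) (hNproj : Module.Projective H N.M)
    (ρQ : (N.M →ₗ[H] P.M) →ₗ[k] (N.M →ₗ[H] P.M) ⊗[k] H)
    (hQc : IsComod k H ρQ) (hQyd : IsYDCompat k H Sinv ρQ)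
    (hQchar : HomCoactChar Sinv N P ρQ) :
    ∀ n : ℕ, injdimLE Sinv P n →
      injdimLE Sinv (YDCat.mk (M := N.M →ₗ[H] P.M) ρQ hQc hQyd) n := by
  rintro n ⟨I, ε, d, hres, hsub⟩
  have hcov := evCov_of_char N P ρQ hQchar
  choose ρI hρI using fun i => exists_evCov hS1 hS2 N (I i)
  refine ⟨fun i => homObj N (I i) (ρI i) (hρI i), postcompH (X := N.M) ε hres.eps_hom.1,
    fun i => postcompH (X := N.M) (d i) (hres.d_hom i).1, ⟨?_, ?_, ?_, ?_, ?_, ?_⟩, ?_⟩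
  · exact post_hom N P (I 0) ρQ hcov _ (hρI 0) ε hres.eps_hom
  · intro i
    exact post_hom N (I i) (I (i + 1)) _ (hρI i) _ (hρI (i + 1)) (d i) (hres.d_hom i)
  · intro i
    exact homObj_injective N (I i) _ (hρI i) (hres.inj i)
  · intro u v huv
    apply LinearMap.ext
    intro x
    exact hres.mono (LinearMap.congr_fun (h := huv) x)
  · exact post_exact N P (I 0) (I 1) ε (d 0) hres.eps_hom (hres.d_hom 0) hres.exact0
  · intro i
    exact post_exact N _ _ _ (d i) (d (i + 1)) (hres.d_hom i) (hres.d_hom (i + 1)) (hres.exact i)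
  · intro i hi
    have := hsub i hi
    exact ⟨fun u v => LinearMap.ext fun x => Subsingleton.elim (α := (I i).M) _ _⟩
end YDPaper
end
end

section
/- Let k be a field and H a commutative Hopf algebra over k with bijective antipode. If M and N are left-right Yetter-Drinfeld modules over H with M finitely generated as a left H-module, then the space Hom_H(M, N) of left H-linear maps from M to N is a left-right Yetter-Drinfeld module, with H-action (hf)(m) = h f(m) and right H-coaction determined by f_0(m) ⊗ f_1 = f(m_0)_0 ⊗ f(m_0)_1 S(m_1) for all m in M. -/
/-!
Common definitions for formalizing "Semisimplicity of the categories of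
Yetter-Drinfeld modules and Long dimodules" (Caenepeel, Guédénon).
-/

open TensorProduct

noncomputable section
namespace YDPaper

section Aux

set_option linter.unusedSectionVars false
set_option linter.unusedSimpArgs false

open WithConv HopfAlgebra

variable {k H : Type} [Field k] [CommRing H] [HopfAlgebra k H]

/-- Every tensor is a finite sum of pure tensors indexed by a finset of naturals. -/
lemma exists_sum_of_closure {α X : Type} [AddCommMonoid X] [Nonempty α] (g : α → X) (x : X)
    (hx : x ∈ AddSubmonoid.closure (Set.range g)) :
    ∃ (t : Finset ℕ) (a : ℕ → α), ∑ i ∈ t, g (a i) = x := by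
  suffices h : ∃ (n : ℕ) (a : ℕ → α), ∑ i ∈ Finset.range n, g (a i) = x by
    obtain ⟨n, a, h⟩ := h
    exact ⟨_, a, h⟩
  induction hx using AddSubmonoid.closure_induction with
  | mem x hx =>
    obtain ⟨y, rfl⟩ := hx
    exact ⟨1, fun _ => y, by simp⟩
  | zero => exact ⟨0, fun _ => Classical.arbitrary α, by simp⟩
  | add x y _ _ hx hy =>
    obtain ⟨n, a, rfl⟩ := hx
    obtain ⟨m, b, rfl⟩ := hy
    refine ⟨n + m, fun i => if i < n then a i else b (i - n), ?_⟩
    rw [Finset.sum_range_add]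
    congr 1
    · refine Finset.sum_congr rfl fun i hi => ?_
      simp [Finset.mem_range.1 hi]
    · refine Finset.sum_congr rfl fun i _ => ?_
      simp

lemma exists_sum_tmul {A B : Type} [AddCommGroup A] [Module k A] [AddCommGroup B] [Module k B]
    (x : A ⊗[k] B) : ∃ (t : Finset ℕ) (a : ℕ → A) (b : ℕ → B), ∑ i ∈ t, a i ⊗ₜ[k] b i = x := by
  obtain ⟨t, a, h⟩ := exists_sum_of_closure (fun p : A × B => p.1 ⊗ₜ[k] p.2) x (by
    induction x with
    | zero => exact zero_mem _
    | tmul a b => exact AddSubmonoid.subset_closure ⟨(a, b), rfl⟩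
    | add x y hx hy => exact add_mem hx hy)
  exact ⟨t, fun i => (a i).1, fun i => (a i).2, h⟩

lemma exists_sum_tmul3 {A B C : Type} [AddCommGroup A] [Module k A] [AddCommGroup B] [Module k B]
    [AddCommGroup C] [Module k C] (x : (A ⊗[k] B) ⊗[k] C) :
    ∃ (t : Finset ℕ) (a : ℕ → A) (b : ℕ → B) (c : ℕ → C),
      ∑ i ∈ t, (a i ⊗ₜ[k] b i) ⊗ₜ[k] c i = x := by
  obtain ⟨t, a, h⟩ := exists_sum_of_closure
    (fun p : A × B × C => (p.1 ⊗ₜ[k] p.2.1) ⊗ₜ[k] p.2.2) x (by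
    induction x with
    | zero => exact zero_mem _
    | tmul u c =>
      induction u with
      | zero => simp
      | tmul a b => exact AddSubmonoid.subset_closure ⟨(a, b, c), rfl⟩
      | add x y hx hy => rw [TensorProduct.add_tmul]; exact add_mem hx hy
    | add x y hx hy => exact add_mem hx hy)
  exact ⟨t, fun i => (a i).1, fun i => (a i).2.1, fun i => (a i).2.2, h⟩

/-! ### Hopf algebra identities -/

variable (k H)

abbrev Sa : H →ₐ[k] H := antipodeAlgHom k H
abbrev i1 : H →ₐ[k] H ⊗[k] H := Algebra.TensorProduct.includeLeft
abbrev i2 : H →ₐ[k] H ⊗[k] H := Algebra.TensorProduct.includeRight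

lemma conv_mul_inv {C : Type} [CommRing C] [Algebra k C] (f : H →ₐ[k] C) :
    toConv f * toConv (f.comp (Sa k H)) = 1 := by
  have h : toConv (AlgHom.id k H) * toConv (Sa k H) = 1 := mul_inv_cancel (toConv (AlgHom.id k H))
  have h2 := AlgHom.comp_convMul_distrib f (toConv (AlgHom.id k H)) (toConv (Sa k H))
  rw [h] at h2
  simp only [ofConv_toConv, AlgHom.comp_id] at h2
  apply WithConv.ofConv_injective
  rw [← h2]
  ext x
  simp [AlgHom.convOne_def, Algebra.ofId_apply]

lemma conv_inv_mul {C : Type} [CommRing C] [Algebra k C] (f : H →ₐ[k] C) :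
    toConv (f.comp (Sa k H)) * toConv f = 1 := by
  have h : toConv (Sa k H) * toConv (AlgHom.id k H) = 1 := inv_mul_cancel (toConv (AlgHom.id k H))
  have h2 := AlgHom.comp_convMul_distrib f (toConv (Sa k H)) (toConv (AlgHom.id k H))
  rw [h] at h2
  simp only [ofConv_toConv, AlgHom.comp_id] at h2
  apply WithConv.ofConv_injective
  rw [← h2]
  ext x
  simp [AlgHom.convOne_def, Algebra.ofId_apply]

lemma Sa_Sa : (Sa k H).comp (Sa k H) = AlgHom.id k H := by
  have h1 : (toConv (AlgHom.id k H))⁻¹ = toConv (Sa k H) := rfl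
  have h2 : (toConv (Sa k H))⁻¹ = toConv ((Sa k H).comp (Sa k H)) := rfl
  rw [← h1, inv_inv] at h2
  exact (congrArg ofConv h2).symm

lemma antipode_antipode' (h : H) : antipode k (antipode k h) = h :=
  DFunLike.congr_fun (Sa_Sa k H) h

/-- `h ↦ h₂ ⊗ h₃ S(h₁)` as an algebra map. -/
def Kalg : H →ₐ[k] H ⊗[k] H :=
  (toConv ((i2 k H).comp (Sa k H)) * toConv (i1 k H) * toConv (i2 k H)).ofConv

/-- `(a ⊗ b) ⊗ c ↦ b ⊗ c S(a)`. -/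
def Tmap : (H ⊗[k] H) ⊗[k] H →ₐ[k] H ⊗[k] H :=
  Algebra.TensorProduct.lift
    (Algebra.TensorProduct.lift ((i2 k H).comp (Sa k H)) (i1 k H) fun _ _ => Commute.all _ _)
    (i2 k H) fun _ _ => Commute.all _ _

lemma Tmap_tmul (a b c : H) :
    Tmap k H ((a ⊗ₜ b) ⊗ₜ c) = b ⊗ₜ (c * antipode k a) := by
  simp [Tmap, mul_comm]

lemma Kalg_eq (h : H) : Kalg k H h = Tmap k H (Delta2 k H h) := by
  simp only [Kalg, Delta2, AlgHom.convMul_def, LinearMap.comp_apply, ofConv_toConv,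
    AlgHom.comp_apply, Bialgebra.comulAlgHom_apply]
  generalize Coalgebra.comul (R := k) h = w
  induction w with
  | zero => simp
  | add x y hx hy => simp only [map_add, hx, hy]
  | tmul x c =>
    simp only [Algebra.TensorProduct.map_tmul, AlgHom.comp_apply, Bialgebra.comulAlgHom_apply,
      LinearMap.rTensor_tmul]
    generalize Coalgebra.comul (R := k) x = w
    induction w with
    | zero => simp
    | add x y hx hy => simp only [map_add, TensorProduct.add_tmul, hx, hy]
    | tmul a b => simp [Tmap]

/-- `b ⊗ c ↦ K(b) (1 ⊗ S(c))`. -/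
def Jalg : H ⊗[k] H →ₐ[k] H ⊗[k] H :=
  Algebra.TensorProduct.lift (Kalg k H) ((i2 k H).comp (Sa k H)) fun _ _ => Commute.all _ _

lemma Jalg_tmul (b c : H) : Jalg k H (b ⊗ₜ c) = Kalg k H b * (1 ⊗ₜ antipode k c) := by
  simp [Jalg]

lemma conj_aux {G : Type} [Monoid G] (a b c : G) (h : a * b = 1) :
    a * (b * c * a) * b = c := by
  calc a * (b * c * a) * b = (a * b) * c * (a * b) := by simp only [mul_assoc]
    _ = c := by rw [h, one_mul, mul_one]

lemma Jalg_Kalg (h : H) : Jalg k H (Kalg k H h) = h ⊗ₜ 1 := by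
  have h1 : (Jalg k H).comp (i1 k H) = Kalg k H := by
    ext x; simp [Jalg]
  have h2 : (Jalg k H).comp (i2 k H) = (i2 k H).comp (Sa k H) := by
    ext x; simp [Jalg]
  have h3 : (Jalg k H).comp ((i2 k H).comp (Sa k H)) = i2 k H := by
    rw [← AlgHom.comp_assoc, h2, AlgHom.comp_assoc, Sa_Sa, AlgHom.comp_id]
  have : (Jalg k H).comp (Kalg k H) = i1 k H := by
    conv_lhs => rw [Kalg]
    rw [AlgHom.comp_convMul_distrib, AlgHom.comp_convMul_distrib]
    simp only [ofConv_toConv, toConv_ofConv, h1, h2, h3]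
    have e1 := conv_mul_inv k H (i2 k H)
    exact congrArg ofConv (conj_aux _ _ (toConv (i1 k H)) e1)
  exact DFunLike.congr_fun this h

/-- `a ⊗ b ↦ S(b) ⊗ S(a)`. -/
def sig : H ⊗[k] H →ₐ[k] H ⊗[k] H :=
  Algebra.TensorProduct.lift ((i2 k H).comp (Sa k H)) ((i1 k H).comp (Sa k H))
    fun _ _ => Commute.all _ _

lemma sig_tmul (a b : H) : sig k H (a ⊗ₜ b) = antipode k b ⊗ₜ antipode k a := by
  simp [sig]

lemma comul_antipode (h : H) :
    Coalgebra.comul (R := k) (antipode k h) = sig k H (Coalgebra.comul (R := k) h) := by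
  have h0 : toConv (Bialgebra.comulAlgHom k H) = toConv (i1 k H) * toConv (i2 k H) := by
    rw [AlgHom.convMul_def]
    congr 1
    ext x
    simp only [AlgHom.comp_apply, Bialgebra.comulAlgHom_apply, ofConv_toConv]
    generalize Coalgebra.comul (R := k) x = w
    induction w with
    | zero => simp
    | add x y hx hy => simp only [map_add, ← hx, ← hy]
    | tmul a b => simp
  have h1 : toConv ((Bialgebra.comulAlgHom k H).comp (Sa k H))
      = toConv ((i2 k H).comp (Sa k H)) * toConv ((i1 k H).comp (Sa k H)) := by
    refine left_inv_eq_right_inv (conv_inv_mul k H (Bialgebra.comulAlgHom k H)) ?_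
    rw [h0, mul_assoc, ← mul_assoc (toConv (i2 k H)), conv_mul_inv, one_mul, conv_mul_inv]
  have h2 := DFunLike.congr_fun (congrArg ofConv h1) h
  refine Eq.trans ?_ (h2.trans ?_)
  · rfl
  · simp only [AlgHom.convMul_def, ofConv_toConv, AlgHom.comp_apply, Bialgebra.comulAlgHom_apply]
    generalize Coalgebra.comul (R := k) h = w
    induction w with
    | zero => simp
    | add x y hx hy => simp only [map_add, ← hx, ← hy]
    | tmul a b => simp [sig]

variable {k H}

section Act

variable (k H)
variable (A : Type) [AddCommGroup A] [Module k A] [Module H A] [IsScalarTower k H A]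

/-- The action of `H ⊗ H` on `A ⊗ H`. -/
def G : H ⊗[k] H →ₗ[k] (A ⊗[k] H →ₗ[k] A ⊗[k] H) :=
  (TensorProduct.homTensorHomMap (RingHom.id k) A H A H).comp
    (TensorProduct.map (Algebra.lsmul k k A).toLinearMap (LinearMap.mul k H))

variable {k H A}
@[simp] lemma G_tmul (a b : H) (n : A) (x : H) :
    G k H A (a ⊗ₜ b) (n ⊗ₜ x) = (a • n) ⊗ₜ (b * x) := by
  simp [G]

lemma compat_iff_s12 (ρ : A →ₗ[k] A ⊗[k] H) :
    IsYDCompat k H (antipode k) ρ ↔ ∀ h m, ρ (h • m) = G k H A (Kalg k H h) (ρ m) := by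
  constructor
  · intro hc h m
    obtain ⟨s, a, b, c, hs⟩ := exists_sum_tmul3 (Delta2 k H h)
    obtain ⟨t, m₀, m₁, ht⟩ := exists_sum_tmul (ρ m)
    rw [hc h m s t a b c m₀ m₁ hs ht, Kalg_eq, ← hs, ← ht]
    simp only [map_sum, LinearMap.sum_apply, Tmap_tmul, G_tmul]
    rw [Finset.sum_comm]
    simp only [mul_right_comm]
  · intro hc h m s t a b c m₀ m₁ hs ht
    rw [hc, Kalg_eq, ← hs, ← ht]
    simp only [map_sum, LinearMap.sum_apply, Tmap_tmul, G_tmul]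
    rw [Finset.sum_comm]
    simp only [mul_right_comm]

variable (k H) (B : Type) [AddCommGroup B] [Module k B]
/-- `R y (n ⊗ x) = n ⊗ x S(y)`. -/
def R : H →ₗ[k] (B ⊗[k] H →ₗ[k] B ⊗[k] H) :=
  (LinearMap.lTensorHom B).comp ((LinearMap.mul k H).flip.comp (antipode k))

variable {k H B}
@[simp] lemma R_tmul (y : H) (n : B) (x : H) : R k H B y (n ⊗ₜ x) = n ⊗ₜ (x * antipode k y) := by
  simp [R, mul_comm]

lemma R_eq (y : H) : R k H B y = LinearMap.lTensor B (LinearMap.mulRight k (antipode k y)) := by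
  ext; simp

lemma R_mul_G (c y : H) (u : H ⊗[k] H) (x : A ⊗[k] H) :
    R k H A (c * y) (G k H A u x) = G k H A (u * (1 ⊗ₜ antipode k c)) (R k H A y x) := by
  induction u with
  | zero => simp
  | add u v hu hv => simp only [map_add, add_mul, LinearMap.add_apply, hu, hv]
  | tmul a b =>
    induction x with
    | zero => simp
    | add u v hu hv => simp only [map_add, hu, hv]
    | tmul n x =>
      simp only [G_tmul, R_tmul, Algebra.TensorProduct.tmul_mul_tmul, mul_one,
        antipode_mul_distrib]
      congr 1
      ring

lemma R_G (y : H) (u : H ⊗[k] H) (x : A ⊗[k] H) :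
    R k H A y (G k H A u x) = G k H A u (R k H A y x) := by
  have := R_mul_G 1 y u x
  simpa [antipode_one, ← Algebra.TensorProduct.one_def] using this

end Act

/-! ### `Hom_H(M, N) ⊗ V` versus `Hom_H(M, N ⊗ V)` -/

section HomTensor

variable {M N V : Type} [AddCommGroup M] [Module k M] [Module H M]
  [IsScalarTower k H M] [SMulCommClass H k M]
  [AddCommGroup N] [Module k N] [Module H N] [IsScalarTower k H N] [SMulCommClass H k N]
  [AddCommGroup V] [Module k V]

open TensorProduct in
lemma equivFinsupp_rTensor {A B ι : Type} [DecidableEq ι] [AddCommGroup A] [Module k A] [AddCommGroup B]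
    [Module k B] (b : Module.Basis ι k V) (f : A →ₗ[k] B) (x : A ⊗[k] V) (i : ι) :
    equivFinsuppOfBasisRight b (LinearMap.rTensor V f x) i
      = f (equivFinsuppOfBasisRight b x i) := by
  induction x with
  | zero => simp
  | add x y hx hy => simp only [map_add, Finsupp.add_apply, hx, hy]
  | tmul a v => simp [equivFinsuppOfBasisRight_apply_tmul_apply]

lemma eval_injective {x y : (M →ₗ[H] N) ⊗[k] V}
    (h : ∀ m, LinearMap.rTensor V (evalAtH (N := N) m) x
      = LinearMap.rTensor V (evalAtH (N := N) m) y) : x = y := by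
  classical
  let b := Module.Basis.ofVectorSpace k V
  apply (TensorProduct.equivFinsuppOfBasisRight b).injective
  ext i m
  have := congrArg (fun z => TensorProduct.equivFinsuppOfBasisRight b z i) (h m)
  simp only [equivFinsupp_rTensor] at this
  exact this

lemma eval_surjective [Module.Finite H M] (φ : M →ₗ[k] N ⊗[k] V)
    (hφ : ∀ (h : H) m, φ (h • m) = LinearMap.rTensor V (smulMap k H h) (φ m)) :
    ∃ x : (M →ₗ[H] N) ⊗[k] V, ∀ m, LinearMap.rTensor V (evalAtH (N := N) m) x = φ m := by
  classical
  let b := Module.Basis.ofVectorSpace k V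
  let c : ∀ i, M →ₗ[H] N := fun i =>
    { toFun := fun m => TensorProduct.equivFinsuppOfBasisRight b (φ m) i
      map_add' := fun x y => by simp
      map_smul' := fun h m => by
        rw [hφ, equivFinsupp_rTensor]; rfl }
  obtain ⟨s, hs⟩ := (Module.Finite.fg_top : (⊤ : Submodule H M).FG)
  let t := s.biUnion fun m => (TensorProduct.equivFinsuppOfBasisRight b (φ m)).support
  have ht : ∀ i, i ∉ t → c i = 0 := by
    intro i hi
    apply LinearMap.ext_on hs
    intro m hm
    by_contra hne
    exact hi (Finset.mem_biUnion.2 ⟨m, hm, Finsupp.mem_support_iff.2 hne⟩)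
  refine ⟨∑ i ∈ t, c i ⊗ₜ b i, fun m => ?_⟩
  apply (TensorProduct.equivFinsuppOfBasisRight b).injective
  ext j
  rw [map_sum, map_sum, Finsupp.finsetSum_apply]
  simp only [LinearMap.rTensor_tmul, TensorProduct.equivFinsuppOfBasisRight_apply_tmul_apply]
  have hval : ∀ i, evalAtH (k := k) (N := N) m (c i)
      = TensorProduct.equivFinsuppOfBasisRight b (φ m) i := fun i => rfl
  have h2 : ∀ i, (b.repr (b i) j) • evalAtH (k := k) (N := N) m (c i)
      = if i = j then evalAtH (k := k) (N := N) m (c j) else 0 := by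
    intro i
    rw [Module.Basis.repr_self, Finsupp.single_apply]
    split_ifs with h
    · subst h; simp
    · simp
  rw [Finset.sum_congr rfl fun i _ => h2 i, Finset.sum_ite_eq', ← hval]
  split_ifs with h
  · rfl
  · rw [ht j h]; simp

end HomTensor

/-! ### The coaction -/

section Coact

variable {M N : Type} [AddCommGroup M] [Module k M] [Module H M]
  [IsScalarTower k H M] [SMulCommClass H k M]
  [AddCommGroup N] [Module k N] [Module H N] [IsScalarTower k H N] [SMulCommClass H k N]
  (ρM : M →ₗ[k] M ⊗[k] H) (ρN : N →ₗ[k] N ⊗[k] H)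

/-- `Θ f (m ⊗ y) = f(m)₀ ⊗ f(m)₁ S(y)`. -/
def Theta (f : M →ₗ[H] N) : M ⊗[k] H →ₗ[k] N ⊗[k] H :=
  TensorProduct.lift ((R k H N).flip.comp (ρN.comp (f.restrictScalars k)))

@[simp] lemma Theta_tmul (f : M →ₗ[H] N) (m : M) (y : H) :
    Theta ρN f (m ⊗ₜ y) = R k H N y (ρN (f m)) := rfl

lemma Theta_add (f g : M →ₗ[H] N) (z : M ⊗[k] H) :
    Theta ρN (f + g) z = Theta ρN f z + Theta ρN g z := by
  induction z with
  | zero => simp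
  | add x y hx hy => simp only [map_add, hx, hy]; abel
  | tmul m y => simp

lemma Theta_smul (c : k) (f : M →ₗ[H] N) (z : M ⊗[k] H) :
    Theta ρN (c • f) z = c • Theta ρN f z := by
  induction z with
  | zero => simp
  | add x y hx hy => simp only [map_add, hx, hy, smul_add]
  | tmul m y => simp

/-- `Θ` as a function of `f`. -/
def P (z : M ⊗[k] H) : (M →ₗ[H] N) →ₗ[k] N ⊗[k] H where
  toFun f := Theta ρN f z
  map_add' f g := Theta_add ρN f g z
  map_smul' c f := Theta_smul ρN c f z

variable {ρN} in
lemma Theta_G (hN : ∀ (h : H) n, ρN (h • n) = G k H N (Kalg k H h) (ρN n))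
    (f : M →ₗ[H] N) (w : H ⊗[k] H) (z : M ⊗[k] H) :
    Theta ρN f (G k H M w z) = G k H N (Jalg k H w) (Theta ρN f z) := by
  induction w with
  | zero => simp
  | add x y hx hy => simp only [map_add, LinearMap.add_apply, hx, hy]
  | tmul b c =>
    induction z with
    | zero => simp
    | add x y hx hy => simp only [map_add, hx, hy]
    | tmul m y =>
      rw [G_tmul, Theta_tmul, Theta_tmul, map_smul, hN, R_mul_G, Jalg_tmul]

variable {ρN} in
lemma Theta_hsmul (hN : ∀ (h : H) n, ρN (h • n) = G k H N (Kalg k H h) (ρN n))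
    (h : H) (f : M →ₗ[H] N) (z : M ⊗[k] H) :
    Theta ρN (h • f) z = G k H N (Kalg k H h) (Theta ρN f z) := by
  induction z with
  | zero => simp
  | add x y hx hy => simp only [map_add, hx, hy]
  | tmul m y =>
    rw [Theta_tmul, Theta_tmul, LinearMap.smul_apply, hN, R_G]

lemma G_one (h : H) (x : N ⊗[k] H) :
    G k H N (h ⊗ₜ 1) x = LinearMap.rTensor H (smulMap k H h) x := by
  induction x with
  | zero => simp
  | add x y hx hy => simp only [map_add, hx, hy]
  | tmul n y => simp [smulMap]

lemma rTensor_eval_G (m : M) (u : H ⊗[k] H) (q : (M →ₗ[H] N) ⊗[k] H) :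
    LinearMap.rTensor H (evalAtH (N := N) m) (G k H (M →ₗ[H] N) u q)
      = G k H N u (LinearMap.rTensor H (evalAtH (N := N) m) q) := by
  induction u with
  | zero => simp
  | add x y hx hy => simp only [map_add, LinearMap.add_apply, hx, hy]
  | tmul a b =>
    induction q with
    | zero => simp
    | add x y hx hy => simp only [map_add, hx, hy]
    | tmul f y => simp [evalAtH]

lemma counit_R (y : H) (x : N ⊗[k] H) :
    (TensorProduct.rid k N) (LinearMap.lTensor N (Coalgebra.counit (R := k) (A := H))
      (R k H N y x)) = Coalgebra.counit (R := k) y •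
      (TensorProduct.rid k N) (LinearMap.lTensor N (Coalgebra.counit (R := k) (A := H)) x) := by
  induction x with
  | zero => simp
  | add x y hx hy => simp only [map_add, hx, hy, smul_add]
  | tmul n h => simp [smul_smul, mul_comm]

lemma counit_Theta (hN : IsComod k H ρN) (f : M →ₗ[H] N) (z : M ⊗[k] H) :
    (TensorProduct.rid k N) (LinearMap.lTensor N (Coalgebra.counit (R := k) (A := H))
      (Theta ρN f z)) = f ((TensorProduct.rid k M)
        (LinearMap.lTensor M (Coalgebra.counit (R := k) (A := H)) z)) := by
  induction z with
  | zero => simp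
  | add x y hx hy => simp only [map_add, hx, hy]
  | tmul m y =>
    rw [Theta_tmul, counit_R, hN.1]
    simp only [LinearMap.lTensor_tmul, TensorProduct.rid_tmul]
    exact ((f.restrictScalars k).map_smul _ _).symm

lemma coassoc_R (y₁ y₂ : H) (x : N ⊗[k] H) :
    TensorProduct.assoc k N H H (LinearMap.rTensor H ((R k H N y₂).comp ρN) (R k H N y₁ x))
      = LinearMap.lTensor N (LinearMap.mulRight k (antipode k y₂ ⊗ₜ[k] antipode k y₁))
        (TensorProduct.assoc k N H H (LinearMap.rTensor H ρN x)) := by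
  induction x with
  | zero => simp
  | add x y hx hy => simp only [map_add, hx, hy]
  | tmul n h =>
    simp only [R_tmul, LinearMap.rTensor_tmul, LinearMap.comp_apply]
    generalize ρN n = w
    induction w with
    | zero => simp
    | add x y hx hy => simp only [map_add, TensorProduct.add_tmul, hx, hy]
    | tmul n h => simp

/-- `Ψ₀(x ⊗ y) = (ρN x₀) S(y) ⊗ x₁`. -/
def Psi : (N ⊗[k] H) ⊗[k] H →ₗ[k] N ⊗[k] (H ⊗[k] H) :=
  TensorProduct.lift (LinearMap.flip
    (((LinearMap.llcomp k _ _ _ (TensorProduct.assoc k N H H).toLinearMap).comp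
      (LinearMap.rTensorHom H)).comp ((LinearMap.lcomp k (N ⊗[k] H) ρN).comp (R k H N))))

@[simp] lemma Psi_tmul (x : N ⊗[k] H) (y : H) :
    Psi ρN (x ⊗ₜ y)
      = TensorProduct.assoc k N H H (LinearMap.rTensor H ((R k H N y).comp ρN) x) := rfl

lemma lTensor_mulRight_add {A : Type} [CommRing A] [Algebra k A] (u v : A) (x : N ⊗[k] A) :
    LinearMap.lTensor N (LinearMap.mulRight k (u + v)) x
      = LinearMap.lTensor N (LinearMap.mulRight k u) x
        + LinearMap.lTensor N (LinearMap.mulRight k v) x := by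
  induction x with
  | zero => simp
  | add x y hx hy => simp only [map_add, hx, hy]; abel
  | tmul n a => simp [mul_add, TensorProduct.tmul_add]

lemma Psi_aux (hN : IsComod k H ρN) (f : M →ₗ[H] N) (m : M) (w : H ⊗[k] H) :
    Psi ρN (LinearMap.rTensor H (Theta ρN f) ((TensorProduct.assoc k M H H).symm (m ⊗ₜ w)))
      = LinearMap.lTensor N (LinearMap.mulRight k (sig k H w))
        (LinearMap.lTensor N (Coalgebra.comul (R := k) (A := H)) (ρN (f m))) := by
  induction w with
  | zero =>
    have : LinearMap.mulRight k (0 : H ⊗[k] H) = 0 := by ext; simp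
    simp [this]
  | add x y hx hy =>
    simp only [map_add, TensorProduct.tmul_add, hx, hy, lTensor_mulRight_add]
  | tmul a b =>
    rw [TensorProduct.assoc_symm_tmul, LinearMap.rTensor_tmul, Theta_tmul, Psi_tmul, coassoc_R,
      hN.2, sig_tmul]

lemma comul_R (y : H) (x : N ⊗[k] H) :
    LinearMap.lTensor N (Coalgebra.comul (R := k) (A := H)) (R k H N y x)
      = LinearMap.lTensor N (LinearMap.mulRight k (sig k H (Coalgebra.comul (R := k) y)))
        (LinearMap.lTensor N (Coalgebra.comul (R := k) (A := H)) x) := by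
  induction x with
  | zero => simp
  | add x y hx hy => simp only [map_add, hx, hy]
  | tmul n h => simp [Bialgebra.comul_mul, comul_antipode]

lemma Psi_Theta (hN : IsComod k H ρN) (f : M →ₗ[H] N) (z : M ⊗[k] H) :
    Psi ρN (LinearMap.rTensor H (Theta ρN f) ((TensorProduct.assoc k M H H).symm
      (LinearMap.lTensor M (Coalgebra.comul (R := k) (A := H)) z)))
      = LinearMap.lTensor N (Coalgebra.comul (R := k) (A := H)) (Theta ρN f z) := by
  induction z with
  | zero => simp
  | add x y hx hy => simp only [map_add, hx, hy]
  | tmul m y => rw [LinearMap.lTensor_tmul, Psi_aux ρN hN, Theta_tmul, comul_R]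

lemma P_add (z z' : M ⊗[k] H) : P (M := M) ρN (z + z') = P ρN z + P ρN z' := by
  ext f; simp [P]

lemma P_zero : P (M := M) ρN (0 : M ⊗[k] H) = 0 := by
  ext f; simp [P]

lemma P_tmul (m : M) (y : H) :
    P ρN (m ⊗ₜ[k] y) = ((R k H N y).comp ρN).comp (evalAtH (k := k) (N := N) m) := by
  ext f; rfl

/-- The existence of the coaction. -/
lemma exists_coact [Module.Finite H M]
    (hMc : ∀ (h : H) m, ρM (h • m) = G k H M (Kalg k H h) (ρM m))
    (hNc : ∀ (h : H) n, ρN (h • n) = G k H N (Kalg k H h) (ρN n)) :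
    ∃ ρQ : (M →ₗ[H] N) →ₗ[k] (M →ₗ[H] N) ⊗[k] H, ∀ f m,
      LinearMap.rTensor H (evalAtH (N := N) m) (ρQ f) = Theta ρN f (ρM m) := by
  have hex : ∀ f : M →ₗ[H] N, ∃ x : (M →ₗ[H] N) ⊗[k] H, ∀ m,
      LinearMap.rTensor H (evalAtH (N := N) m) x = Theta ρN f (ρM m) := by
    intro f
    refine eval_surjective ((Theta ρN f).comp ρM) fun h m => ?_
    rw [LinearMap.comp_apply, LinearMap.comp_apply, hMc, Theta_G hNc, Jalg_Kalg, G_one]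
  choose q hq using hex
  refine ⟨{ toFun := q, map_add' := fun f g => ?_, map_smul' := fun c f => ?_ }, hq⟩
  · refine eval_injective fun m => ?_
    rw [map_add, hq, hq, hq, Theta_add]
  · refine eval_injective fun m => ?_
    rw [RingHom.id_apply, map_smul, hq, hq, Theta_smul]

lemma coact_comod (hM : IsComod k H ρM) (hN : IsComod k H ρN)
    (ρQ : (M →ₗ[H] N) →ₗ[k] (M →ₗ[H] N) ⊗[k] H)
    (hQ : ∀ f m, LinearMap.rTensor H (evalAtH (N := N) m) (ρQ f) = Theta ρN f (ρM m)) :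
    IsComod k H ρQ := by
  constructor
  · intro f
    ext m
    have key : ∀ q : (M →ₗ[H] N) ⊗[k] H,
        (TensorProduct.rid k (M →ₗ[H] N) (LinearMap.lTensor (M →ₗ[H] N)
          (Coalgebra.counit (R := k) (A := H)) q)) m
        = TensorProduct.rid k N (LinearMap.lTensor N (Coalgebra.counit (R := k) (A := H))
          (LinearMap.rTensor H (evalAtH (N := N) m) q)) := by
      intro q
      induction q with
      | zero => simp
      | add x y hx hy => simp only [map_add, LinearMap.add_apply, hx, hy]
      | tmul f y => simp [evalAtH]
    rw [key, hQ, counit_Theta ρN hN, hM.1]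
  · intro f
    refine eval_injective fun m => ?_
    have key1 : ∀ q : (M →ₗ[H] N) ⊗[k] H,
        LinearMap.rTensor (H ⊗[k] H) (evalAtH (N := N) m)
          (TensorProduct.assoc k (M →ₗ[H] N) H H (LinearMap.rTensor H ρQ q))
        = TensorProduct.assoc k N H H (LinearMap.rTensor H (P ρN (ρM m)) q) := by
      intro q
      induction q with
      | zero => simp
      | add x y hx hy => simp only [map_add, hx, hy]
      | tmul g y =>
        have hP : P ρN (ρM m) g = LinearMap.rTensor H (evalAtH (N := N) m) (ρQ g) := (hQ g m).symm
        rw [LinearMap.rTensor_tmul, LinearMap.rTensor_tmul, hP]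
        generalize ρQ g = w
        induction w with
        | zero => simp
        | add x y hx hy => simp only [map_add, TensorProduct.add_tmul, hx, hy]
        | tmul g x => simp
    have key2 : ∀ z : M ⊗[k] H,
        TensorProduct.assoc k N H H (LinearMap.rTensor H (P ρN z) (ρQ f))
        = Psi ρN (LinearMap.rTensor H (Theta ρN f) (LinearMap.rTensor H ρM z)) := by
      intro z
      induction z with
      | zero => simp [P_zero]
      | add x y hx hy =>
        simp only [map_add, P_add, LinearMap.rTensor_add, LinearMap.add_apply, hx, hy]
      | tmul m y =>
        rw [P_tmul, LinearMap.rTensor_comp_apply, hQ, LinearMap.rTensor_tmul,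
          LinearMap.rTensor_tmul, Psi_tmul]
    have key3 : LinearMap.rTensor H ρM (ρM m) = (TensorProduct.assoc k M H H).symm
        (LinearMap.lTensor M (Coalgebra.comul (R := k) (A := H)) (ρM m)) := by
      rw [← hM.2, LinearEquiv.symm_apply_apply]
    have key4 : ∀ q : (M →ₗ[H] N) ⊗[k] H,
        LinearMap.rTensor (H ⊗[k] H) (evalAtH (N := N) m)
          (LinearMap.lTensor (M →ₗ[H] N) (Coalgebra.comul (R := k) (A := H)) q)
        = LinearMap.lTensor N (Coalgebra.comul (R := k) (A := H))
          (LinearMap.rTensor H (evalAtH (N := N) m) q) := by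
      intro q
      induction q with
      | zero => simp
      | add x y hx hy => simp only [map_add, hx, hy]
      | tmul g y => simp
    rw [key1, key2, key3, Psi_Theta ρN hN, key4, hQ]

end Coact

end Aux

/-- Proposition 1.8. Let `k` be a field and `H` a commutative
Hopf algebra over `k` with bijective antipode. If `M`, `N` are Yetter-Drinfeld
modules with `M` finitely generated as a left `H`-module, then `Hom_H(M, N)` is a
Yetter-Drinfeld module, with `H`-action `(h f)(m) = h f(m)` and right `H`-coaction
determined by `f₀(m) ⊗ f₁ = f(m₀)₀ ⊗ f(m₀)₁ S(m₁)`. -/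
theorem homH_is_YetterDrinfeld_module
    (k H : Type) [Field k] [CommRing H] [HopfAlgebra k H]
    (Sinv : H →ₗ[k] H)
    (hS1 : ∀ h : H, Sinv (HopfAlgebra.antipode (R := k) (A := H) h) = h)
    (hS2 : ∀ h : H, HopfAlgebra.antipode (R := k) (A := H) (Sinv h) = h)
    (M N : YDCat k H Sinv) (hM : Module.Finite H M.M) :
    (∀ (h : H) (f : M.M →ₗ[H] N.M) (m : M.M), (h • f) m = h • f m) ∧
    ∃ ρQ : (M.M →ₗ[H] N.M) →ₗ[k] (M.M →ₗ[H] N.M) ⊗[k] H,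
      IsComod k H ρQ ∧ IsYDCompat k H Sinv ρQ ∧ HomCoactChar Sinv M N ρQ := by
  refine ⟨fun _ _ _ => rfl, ?_⟩
  have hS : Sinv = HopfAlgebra.antipode (R := k) (A := H) := by
    ext h
    conv_lhs => rw [← antipode_antipode' k H h]
    exact hS1 _
  subst hS
  have hMc := (compat_iff_s12 M.ρ).1 M.compat
  have hNc := (compat_iff_s12 N.ρ).1 N.compat
  obtain ⟨ρQ, hQ⟩ := exists_coact M.ρ N.ρ hMc hNc
  refine ⟨ρQ, coact_comod M.ρ N.ρ M.comod N.comod ρQ hQ, ?_, ?_⟩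
  · rw [compat_iff_s12]
    intro h f
    refine eval_injective fun m => ?_
    rw [hQ, Theta_hsmul hNc, rTensor_eval_G, hQ]
  · intro f m t m₀ m₁ ht
    rw [hQ, ← ht, map_sum]
    simp only [Theta_tmul, R_eq]
end YDPaper
end
end
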